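/- arXiv:2311.02410 — 3 statements merged into one kernel-verified Lean document; each statement's English description precedes it below -/
import Mathlib

section
/- The identity R(u) G₁ R(v) G₂ = G₂ R(v) G₁ R(u) holds in the graded tensor product (End V) ⊗ (End V) with coefficients in ℂ(u, v), where G₁ = G ⊗ 1 and G₂ = 1 ⊗ G. -/
/-!
STATEMENT 7: The identity R(u) G₁ R(v) G₂ = G₂ R(v) G₁ R(u) holds in the graded
tensor square (End V) ⊗ (End V) with coefficients in ℂ(u,v), where G₁ = G ⊗ 1,
G₂ = 1 ⊗ G and G = diag(ε₁,…,ε_{m+n}) with ε_i = 1 for i ≤ ℓ and ε_i = −1 for i > ℓ.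

The graded tensor square is modelled by coefficient functions with respect to the
basis e_{ij} ⊗ e_{kl}, and ℂ(u,v) is the fraction field of ℂ[u,v].
-/

noncomputable section

/-- parity of the index i ∈ {1,…,m+n}. -/
def par (m : ℕ) {N : ℕ} (i : Fin N) : ℕ := if (i : ℕ) < m then 0 else 1

/-- Coefficients of an element of the graded tensor square of End V. -/
abbrev E2 (N : ℕ) (K : Type*) := ((Fin N × Fin N) × (Fin N × Fin N)) → K

/-- Multiplication in the graded tensor square (End V) ⊗ (End V). -/
def mulE2 (m : ℕ) {N : ℕ} {K : Type*} [CommRing K] (x y : E2 N K) : E2 N K := fun p =>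
  ∑ a : Fin N, ∑ b : Fin N,
    (-1 : K) ^ ((par m a + par m p.1.2) * (par m p.2.1 + par m b)) *
      x ((p.1.1, a), (p.2.1, b)) * y ((a, p.1.2), (b, p.2.2))

/-- Scalar multiplication. -/
def smulE2 {N : ℕ} {K : Type*} [CommRing K] (c : K) (x : E2 N K) : E2 N K := fun p => c * x p

/-- The identity element 1 ⊗ 1. -/
def oneE2 {N : ℕ} (K : Type*) [CommRing K] : E2 N K := fun p =>
  if p.1.1 = p.1.2 ∧ p.2.1 = p.2.2 then 1 else 0

/-- The graded permutation operator P = Σ_{i,j} (−1)^{j̄} e_{ij} ⊗ e_{ji}. -/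
def Pmat (m : ℕ) {N : ℕ} (K : Type*) [CommRing K] : E2 N K := fun p =>
  if p.2.1 = p.1.2 ∧ p.2.2 = p.1.1 then (-1 : K) ^ (par m p.1.2) else 0

/-- The super Yang R-matrix R(w) = 1 − P·w⁻¹. -/
def Rmat (m : ℕ) {N : ℕ} {K : Type*} [Field K] (w : K) : E2 N K :=
  oneE2 K - smulE2 w⁻¹ (Pmat m K)

/-- ε_i = 1 for i ≤ ℓ (i.e. (i:ℕ) < ℓ with 0-based indexing), ε_i = −1 otherwise. -/
def eps (ℓ : ℕ) {N : ℕ} (K : Type*) [CommRing K] (i : Fin N) : K :=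
  if (i : ℕ) < ℓ then 1 else -1

/-- G₁ = G ⊗ 1 = Σ_{i,k} ε_i e_{ii} ⊗ e_{kk}. -/
def G1 (ℓ : ℕ) {N : ℕ} (K : Type*) [CommRing K] : E2 N K := fun p =>
  if p.1.1 = p.1.2 ∧ p.2.1 = p.2.2 then eps ℓ K p.1.1 else 0

/-- G₂ = 1 ⊗ G = Σ_{i,k} ε_k e_{ii} ⊗ e_{kk}. -/
def G2 (ℓ : ℕ) {N : ℕ} (K : Type*) [CommRing K] : E2 N K := fun p =>
  if p.1.1 = p.1.2 ∧ p.2.1 = p.2.2 then eps ℓ K p.2.1 else 0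

/-- The field ℂ(u,v). -/
abbrev K2 : Type := FractionRing (MvPolynomial (Fin 2) ℂ)

/-- The variables u, v ∈ ℂ(u,v). -/
def uvar (a : Fin 2) : K2 := algebraMap (MvPolynomial (Fin 2) ℂ) K2 (MvPolynomial.X a)

section Products

variable {m ℓ N : ℕ} {K : Type*} [Field K]

lemma mulE2_G1 (x : E2 N K) (i j k l : Fin N) :
    mulE2 m x (G1 ℓ K) ((i, j), (k, l)) = x ((i, j), (k, l)) * eps ℓ K j := by
  have h : Even ((par m j + par m j) * (par m k + par m l)) :=
    Even.mul_right ⟨_, rfl⟩ _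
  simp [mulE2, G1, ite_and, h.neg_one_pow]

lemma mulE2_G2 (x : E2 N K) (i j k l : Fin N) :
    mulE2 m x (G2 ℓ K) ((i, j), (k, l)) = x ((i, j), (k, l)) * eps ℓ K l := by
  have h : Even ((par m j + par m j) * (par m k + par m l)) :=
    Even.mul_right ⟨_, rfl⟩ _
  simp [mulE2, G2, ite_and, h.neg_one_pow]

lemma mulE2_Rmat (x : E2 N K) (w : K) (i j k l : Fin N) :
    mulE2 m x (Rmat m w) ((i, j), (k, l)) = x ((i, j), (k, l)) -
      w⁻¹ * ((-1) ^ ((par m l + par m j) * (par m k + par m j) + par m j) *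
        x ((i, l), (k, j))) := by
  have h : Even ((par m j + par m j) * (par m k + par m l)) :=
    Even.mul_right ⟨_, rfl⟩ _
  simp [mulE2, Rmat, oneE2, smulE2, Pmat, mul_sub, ite_and, Finset.sum_sub_distrib,
    h.neg_one_pow, pow_add]
  ring

lemma Rmat_apply (w : K) (i j k l : Fin N) :
    Rmat m w ((i, j), (k, l)) = (if i = j ∧ k = l then 1 else 0) -
      w⁻¹ * (if k = j ∧ l = i then (-1) ^ par m j else 0) := rfl

lemma G2_apply (i j k l : Fin N) :
    G2 ℓ K ((i, j), (k, l)) = if i = j ∧ k = l then eps ℓ K k else 0 := rfl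

lemma eps_mul_self (i : Fin N) : eps ℓ K i * eps ℓ K i = 1 := by
  unfold eps; split_ifs <;> simp

lemma par_eq_zero_or_one (i : Fin N) : par m i = 0 ∨ par m i = 1 := by
  unfold par; split_ifs <;> simp

/-- The reflection equation for the diagonal matrix `G`, over any field. -/
theorem reflection_equation (u v : K) :
    mulE2 (N := N) m (mulE2 m (mulE2 m (Rmat m u) (G1 ℓ K)) (Rmat m v)) (G2 ℓ K) =
      mulE2 m (mulE2 m (mulE2 m (G2 ℓ K) (Rmat m v)) (G1 ℓ K)) (Rmat m u) := by
  funext ⟨⟨i, j⟩, k, l⟩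
  simp only [mulE2_G2, mulE2_Rmat, mulE2_G1, G2_apply, Rmat_apply]
  have hi := eps_mul_self (ℓ := ℓ) (K := K) i
  have hk := eps_mul_self (ℓ := ℓ) (K := K) k
  by_cases h₁ : i = j ∧ k = l
  · obtain ⟨rfl, rfl⟩ := h₁
    by_cases h : k = i
    · subst h
      rcases par_eq_zero_or_one (m := m) k with p | p <;> simp [p] <;> grind
    · rcases par_eq_zero_or_one (m := m) i with p | p <;>
        rcases par_eq_zero_or_one (m := m) k with q | q <;>
          simp [p, q, h, Ne.symm h] <;> grind
  · by_cases h₂ : k = j ∧ l = i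
    · obtain ⟨rfl, rfl⟩ := h₂
      have h : l ≠ k := fun h => h₁ ⟨h, h.symm⟩
      rcases par_eq_zero_or_one (m := m) l with p | p <;>
        rcases par_eq_zero_or_one (m := m) k with q | q <;>
          simp [p, q, h, h.symm] <;> grind
    · have h₃ : ¬ (i = l ∧ k = j) := fun h => h₂ ⟨h.2, h.1.symm⟩
      have h₄ : ¬ (k = l ∧ j = i) := fun h => h₁ ⟨h.2.symm, h.1⟩
      simp [h₁, h₂, h₃, h₄]

end Products

theorem statement7 (m n ℓ : ℕ) (hN : 1 ≤ m + n) (hl1 : 1 ≤ ℓ) (hl2 : ℓ ≤ m + n) :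
    mulE2 (N := m + n) (K := K2) m
        (mulE2 m (mulE2 m (Rmat m (uvar 0)) (G1 ℓ _)) (Rmat m (uvar 1)))
        (G2 ℓ _)
      = mulE2 m
        (mulE2 m (mulE2 m (G2 ℓ _) (Rmat m (uvar 1))) (G1 ℓ _))
        (Rmat m (uvar 0)) := by
  exact reflection_equation _ _
end
end

section
/- Define deg t_{ij}^{(r)} = r − 1 and deg t_{ij}^{(−r)} = −r, and for p ∈ ℤ let DY₀(gl_{m|n})^{(p)} be the ℂ-span of the images in DY₀(gl_{m|n}) of all monomials in the generators of total degree at most p. Then for every x ∈ DY₀(gl_{m|n}) and every integer p there exists a finite ℂ-linear combination y of ordered monomials such that x − y ∈ DY₀(gl_{m|n})^{(p)}; that is, the ordered monomials topologically span DY₀(gl_{m|n}) with respect to the topology induced by this filtration. -/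
/-!
The level-0 double Yangian DY₀(gl_{m|n}), presented by generators and relations.
Generators: `Sum.inl (i,j,r)` represents t_{ij}^{(r+1)}, `Sum.inr (i,j,r)` represents
t_{ij}^{(−(r+1))}.  The relations are (a) the Yangian relations, (b) the dual Yangian
relations, and (c) the mixed relations obtained by equating coefficients of u^{−r} v^{s}
and matrix units in
  (u−v)(T₁(u) T₂⁺(v) − T₂⁺(v) T₁(u)) = P T₁(u) T₂⁺(v) − T₂⁺(v) T₁(u) P.
Computing the matrix entry at e_{ij} ⊗ e_{kl} of both sides of this identity in the
graded tensor product (End V) ⊗ (End V) ⊗ A (Koszul signs included) yields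
  (u−v)·((−1)^{A+pq} t_{ij}(u)t⁺_{kl}(v) − (−1)^{A} t⁺_{kl}(v)t_{ij}(u))
    = (−1)^{B} (t_{kj}(u)t⁺_{il}(v) − t⁺_{kj}(v)t_{il}(u)),
with A = ī j̄ + j̄ + k̄ l̄ + l̄, p = ī+j̄, q = k̄+l̄, B = j̄ + l̄ + ī l̄ + k̄ l̄ + j̄ l̄;
the constructor `mixed` below is the coefficient of u^{−r} v^{s} of this identity.
(The coefficients of positive powers of u vanish identically.)
-/

noncomputable section

/-- Index type: `inl (i,j,r)` ↦ t_{ij}^{(r+1)}, `inr (i,j,r)` ↦ t_{ij}^{(−(r+1))}. -/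
abbrev GD (m n : ℕ) := (Fin (m + n) × Fin (m + n) × ℕ) ⊕ (Fin (m + n) × Fin (m + n) × ℕ)

/-- The free algebra on the generators. -/
abbrev FD (m n : ℕ) := FreeAlgebra ℂ (GD m n)

/-- Coefficient of u^{−p} in t_{ij}(u): t^{(0)} = δ, t^{(p)} for p ≥ 1. -/
def tc (m n : ℕ) (i j : Fin (m + n)) : ℕ → FD m n
  | 0 => if i = j then 1 else 0
  | p + 1 => FreeAlgebra.ι ℂ (Sum.inl (i, j, p))

/-- t_{ij}^{(−p)} (p ≥ 1). -/
def tdD (m n : ℕ) (i j : Fin (m + n)) (p : ℕ) : FD m n :=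
  FreeAlgebra.ι ℂ (Sum.inr (i, j, p - 1))

/-- Coefficient of v^{s} in t⁺_{ij}(v) = δ_{ij} − Σ_{r≥1} t_{ij}^{(−r)} v^{r−1}. -/
def tdc (m n : ℕ) (i j : Fin (m + n)) (s : ℕ) : FD m n :=
  (if s = 0 ∧ i = j then 1 else 0) - FreeAlgebra.ι ℂ (Sum.inr (i, j, s))

/-- The expression (−1)^{A+pq} (coeff u^{−r} of t_{ij}(u))·(coeff v^{s} of t⁺_{kl}(v))
  − (−1)^{A} (coeff v^{s} of t⁺_{kl}(v))·(coeff u^{−r} of t_{ij}(u)). -/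
def Xmix (m n : ℕ) (i j k l : Fin (m + n)) (r s : ℕ) : FD m n :=
  (-1 : FD m n) ^ (par m i * par m j + par m j + par m k * par m l + par m l
      + (par m i + par m j) * (par m k + par m l)) *
    (tc m n i j r * tdc m n k l s)
  - (-1 : FD m n) ^ (par m i * par m j + par m j + par m k * par m l + par m l) *
    (tdc m n k l s * tc m n i j r)

/-- The defining relations of the level-0 double Yangian. -/
inductive DRel (m n : ℕ) : FD m n → FD m n → Prop
  | yang (i j k l : Fin (m + n)) (r s : ℕ) :
      DRel m n
        (tc m n i j (r + 1) * tc m n k l (s + 1)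
          - (-1 : FD m n) ^ ((par m i + par m j) * (par m k + par m l)) *
              (tc m n k l (s + 1) * tc m n i j (r + 1)))
        ((-1 : FD m n) ^ (par m i * par m j + par m i * par m k + par m j * par m k) *
          ∑ a ∈ Finset.range (min (r + 1) (s + 1)),
            (tc m n k j a * tc m n i l (r + s + 1 - a)
              - tc m n k j (r + s + 1 - a) * tc m n i l a))
  | dual (i j k l : Fin (m + n)) (r s : ℕ) :
      DRel m n
        (tdD m n i j (r + 1) * tdD m n k l (s + 1)
          - (-1 : FD m n) ^ ((par m i + par m j) * (par m k + par m l)) *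
              (tdD m n k l (s + 1) * tdD m n i j (r + 1)))
        ((-1 : FD m n) ^ (par m i * par m j + par m i * par m k + par m j * par m k) *
          ((if k = j then tdD m n i l (r + s + 2) else 0)
            - (if i = l then tdD m n k j (r + s + 2) else 0)
            + ∑ a ∈ Finset.range (min (r + 1) (s + 1)),
                (tdD m n k j (r + s + 2 - a) * tdD m n i l (a + 1)
                  - tdD m n k j (a + 1) * tdD m n i l (r + s + 2 - a))))
  | mixed (i j k l : Fin (m + n)) (r s : ℕ) :
      DRel m n
        (Xmix m n i j k l (r + 1) s - (if s = 0 then 0 else Xmix m n i j k l r (s - 1)))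
        ((-1 : FD m n) ^ (par m j + par m l + par m i * par m l + par m k * par m l
            + par m j * par m l) *
          (tc m n k j r * tdc m n i l s - tdc m n k j s * tc m n i l r))

/-- The level-0 double Yangian DY₀(gl_{m|n}). -/
abbrev DY (m n : ℕ) := RingQuot (DRel m n)

/-- The image of a generator in DY₀(gl_{m|n}). -/
def genD (m n : ℕ) (g : GD m n) : DY m n :=
  RingQuot.mkAlgHom ℂ (DRel m n) (FreeAlgebra.ι ℂ g)


/-- deg t_{ij}^{(r)} = r − 1, deg t_{ij}^{(−r)} = −r. -/
def degG (m n : ℕ) : GD m n → ℤ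
  | Sum.inl (_, _, r) => (r : ℤ)
  | Sum.inr (_, _, r) => -((r : ℤ) + 1)

/-- The element of DY₀ given by a monomial in the generators. -/
def monoD (m n : ℕ) (l : List (GD m n)) : DY m n :=
  (l.map (genD m n)).prod

/-- The filtration component DY₀^{(p)}: the span of (images of) monomials in the
generators of total degree at most p. -/
def Fil (m n : ℕ) (p : ℤ) : Submodule ℂ (DY m n) :=
  Submodule.span ℂ {x | ∃ l : List (GD m n), (l.map (degG m n)).sum ≤ p ∧ x = monoD m n l}

/-- Strict lexicographic precedence of (i,j) before (k,l). -/
def lexLT (m n : ℕ) (i j k l : Fin (m + n)) : Prop :=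
  i < k ∨ (i = k ∧ j < l)

/-- The total order on the generators: t^{(−r)} ≺ t^{(s)} always; within each family,
lexicographic order of (i,j); for equal (i,j), t_{ij}^{(r)} ≺ t_{ij}^{(s)} for r < s and
t_{ij}^{(−s)} ≺ t_{ij}^{(−r)} for r < s. -/
def leG (m n : ℕ) : GD m n → GD m n → Prop
  | Sum.inr _, Sum.inl _ => True
  | Sum.inl _, Sum.inr _ => False
  | Sum.inl (i, j, r), Sum.inl (k, l, s) =>
      lexLT m n i j k l ∨ ((i, j) = (k, l) ∧ r ≤ s)
  | Sum.inr (i, j, r), Sum.inr (k, l, s) =>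
      lexLT m n i j k l ∨ ((i, j) = (k, l) ∧ s ≤ r)

/-- A generator is odd iff ī + j̄ = 1. -/
def isOddD (m n : ℕ) : GD m n → Prop
  | Sum.inl (i, j, _) => par m i ≠ par m j
  | Sum.inr (i, j, _) => par m i ≠ par m j

/-- Ordered monomials with respect to the fixed order, with odd generators occurring
at most once. -/
def OrderedMonomialD (m n : ℕ) (l : List (GD m n)) : Prop :=
  l.Pairwise (leG m n) ∧ ∀ g ∈ l, isOddD m n g → l.count g ≤ 1

section Straightening

variable {G A : Type*} [Ring A] [Algebra ℂ A]

/-- The span of the monomials in `gen` of degree less than `d`, together with those of degree at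
most `d` and length less than `L`. -/
def lowerSpan (gen : G → A) (deg : G → ℤ) (d : ℤ) (L : ℕ) : Submodule ℂ A :=
  Submodule.span ℂ {x | ∃ l : List G,
    ((l.map deg).sum < d ∨ ((l.map deg).sum ≤ d ∧ l.length < L)) ∧ x = (l.map gen).prod}

variable {gen : G → A} {deg : G → ℤ}

lemma prod_mem_lowerSpan {d : ℤ} {L : ℕ} (l : List G)
    (h : (l.map deg).sum < d ∨ ((l.map deg).sum ≤ d ∧ l.length < L)) :
    (l.map gen).prod ∈ lowerSpan gen deg d L :=
  Submodule.subset_span ⟨l, h, rfl⟩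

lemma gen_mem_lowerSpan {d : ℤ} (g : G) (h : deg g ≤ d) : gen g ∈ lowerSpan gen deg d 2 := by
  simpa using prod_mem_lowerSpan (gen := gen) (deg := deg) (d := d) (L := 2) [g]
    (Or.inr ⟨by simpa using h, by simp⟩)

lemma gen_mul_gen_mem_lowerSpan {d : ℤ} (g h : G) (hd : deg g + deg h < d) :
    gen g * gen h ∈ lowerSpan gen deg d 2 := by
  simpa using prod_mem_lowerSpan (gen := gen) (deg := deg) (d := d) (L := 2) [g, h]
    (Or.inl (by simpa using hd))

lemma lowerSpan_gen_mul (g : G) {d : ℤ} {L : ℕ} {x : A} (hx : x ∈ lowerSpan gen deg d L) :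
    gen g * x ∈ lowerSpan gen deg (deg g + d) (L + 1) := by
  refine (Submodule.span_le (p := (lowerSpan gen deg (deg g + d) (L + 1)).comap
    (LinearMap.mulLeft ℂ (gen g)))).2 ?_ hx
  rintro _ ⟨l, hl, rfl⟩
  refine Submodule.subset_span ⟨g :: l, ?_, by simp⟩
  simp only [List.map_cons, List.sum_cons, List.length_cons]
  omega

lemma lowerSpan_mul_prod (l : List G) {d : ℤ} {L : ℕ} {x : A}
    (hx : x ∈ lowerSpan gen deg d L) :
    x * (l.map gen).prod ∈ lowerSpan gen deg (d + (l.map deg).sum) (L + l.length) := by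
  refine (Submodule.span_le (p := (lowerSpan gen deg (d + (l.map deg).sum) (L + l.length)).comap
    (LinearMap.mulRight ℂ (l.map gen).prod))).2 ?_ hx
  rintro _ ⟨k, hk, rfl⟩
  refine Submodule.subset_span ⟨k ++ l, ?_, by simp⟩
  simp only [List.map_append, List.sum_append, List.length_append]
  omega

/-- If generators commute up to nonzero scalars and lower terms, then so do the letters of any
monomial. -/
lemma exists_prod_sub_smul_mem_lowerSpan_of_perm
    (hcomm : ∀ g h : G, ∃ c : ℂ,
      gen g * gen h - c • (gen h * gen g) ∈ lowerSpan gen deg (deg g + deg h) 2)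
    {l l' : List G} (hp : l.Perm l') :
    ∃ c : ℂ, (l.map gen).prod - c • (l'.map gen).prod ∈
      lowerSpan gen deg (l.map deg).sum l.length := by
  induction hp with
  | nil => exact ⟨1, by simp⟩
  | cons g _ ih =>
    obtain ⟨c, hc⟩ := ih
    refine ⟨c, ?_⟩
    simpa [mul_sub] using lowerSpan_gen_mul g hc
  | swap g h l =>
    obtain ⟨c, hc⟩ := hcomm h g
    refine ⟨c, ?_⟩
    have := lowerSpan_mul_prod l hc
    rw [add_comm 2, add_assoc] at this
    simpa [sub_mul, mul_assoc] using this
  | trans h₁ _ ih₁ ih₂ =>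
    obtain ⟨c₁, hc₁⟩ := ih₁
    obtain ⟨c₂, hc₂⟩ := ih₂
    refine ⟨c₁ * c₂, ?_⟩
    rw [← (h₁.map deg).sum_eq, ← h₁.length_eq] at hc₂
    have := add_mem hc₁ (Submodule.smul_mem _ c₁ hc₂)
    rwa [smul_sub, smul_smul, sub_add_sub_cancel] at this

/-- Topological spanning by ordered monomials, for generators which commute up to scalars and lower
terms and such that the squares of the generators satisfying `odd` are lower terms. -/
theorem prod_mem_ordered_sup_filtration (le : G → G → Prop) [DecidableRel le] [BEq G] [LawfulBEq G]
    [Std.Total le] [IsTrans G le] (odd : G → Prop)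
    (hcomm : ∀ g h : G, ∃ c : ℂ,
      gen g * gen h - c • (gen h * gen g) ∈ lowerSpan gen deg (deg g + deg h) 2)
    (hsq : ∀ g, odd g → gen g * gen g ∈ lowerSpan gen deg (deg g + deg g) 2)
    (p : ℤ) (l : List G) :
    (l.map gen).prod ∈
      Submodule.span ℂ {z | ∃ l : List G,
          (l.Pairwise le ∧ ∀ g ∈ l, odd g → l.count g ≤ 1) ∧ z = (l.map gen).prod} ⊔
        Submodule.span ℂ {z | ∃ l : List G, (l.map deg).sum ≤ p ∧ z = (l.map gen).prod} := by
  set S := Submodule.span ℂ {z | ∃ l : List G,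
    (l.Pairwise le ∧ ∀ g ∈ l, odd g → l.count g ≤ 1) ∧ z = (l.map gen).prod} ⊔
      Submodule.span ℂ {z | ∃ l : List G, (l.map deg).sum ≤ p ∧ z = (l.map gen).prod} with hS
  suffices H : ∀ (e L : ℕ) (l : List G), (l.map deg).sum ≤ p + e → l.length = L →
      (l.map gen).prod ∈ S from
    H ((l.map deg).sum - p).toNat _ l (by omega) rfl
  intro e
  induction e with
  | zero =>
    intro L l hl _
    exact Submodule.mem_sup_right (Submodule.subset_span ⟨l, by simpa using hl, rfl⟩)
  | succ e ihe =>
    intro L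
    induction L using Nat.strong_induction_on with
    | _ L ihL =>
      intro l hl hlen
      have hlow : lowerSpan gen deg (l.map deg).sum l.length ≤ S := by
        refine Submodule.span_le.2 ?_
        rintro _ ⟨k, hk | ⟨hk, hk'⟩, rfl⟩
        · exact ihe _ k (by push_cast at hl; omega) rfl
        · exact ihL _ (hlen ▸ hk') k (hk.trans hl) rfl
      have key : ∀ l' : List G, l.Perm l' → (l'.map gen).prod ∈ S → (l.map gen).prod ∈ S := by
        intro l' hp hl'
        obtain ⟨c, hc⟩ := exists_prod_sub_smul_mem_lowerSpan_of_perm hcomm hp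
        simpa using add_mem (hlow hc) (Submodule.smul_mem _ c hl')
      by_cases hodd : ∀ g ∈ l, odd g → l.count g ≤ 1
      · have hp := List.perm_insertionSort le l
        refine key _ hp.symm (Submodule.mem_sup_left (Submodule.subset_span
          ⟨_, ⟨List.pairwise_insertionSort le l, fun g hg ho => ?_⟩, rfl⟩))
        rw [hp.count_eq]
        exact hodd g (hp.mem_iff.1 hg) ho
      · push Not at hodd
        obtain ⟨g, hg, ho, hc⟩ := hodd
        have h₁ := List.perm_cons_erase hg
        have hg' : g ∈ l.erase g := by
          rw [← List.count_pos_iff, List.count_erase_self]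
          omega
        have h₂ : l.Perm (g :: g :: (l.erase g).erase g) :=
          h₁.trans ((List.perm_cons_erase hg').cons g)
        refine key _ h₂ (hlow ?_)
        have := lowerSpan_mul_prod ((l.erase g).erase g) (hsq g ho)
        rw [add_comm 2, add_assoc] at this
        rw [(h₂.map deg).sum_eq, h₂.length_eq]
        simpa [mul_assoc] using this

end Straightening

section Relations

variable {m n : ℕ}

/-- The images of the monomials in the generators of degree less than `d`, or of degree at most
`d` and length less than two. -/
abbrev lowerDY (m n : ℕ) (d : ℤ) : Submodule ℂ (DY m n) := lowerSpan (genD m n) (degG m n) d 2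

/-- The quotient map onto the double Yangian. -/
abbrev quotD (m n : ℕ) : FD m n →ₐ[ℂ] DY m n := RingQuot.mkAlgHom ℂ (DRel m n)

lemma lowerDY_mono {d e : ℤ} (h : d ≤ e) : lowerDY m n d ≤ lowerDY m n e := by
  refine Submodule.span_mono ?_
  rintro _ ⟨l, hl, rfl⟩
  exact ⟨l, by omega, rfl⟩

lemma neg_one_pow_mul_mem_iff {A : Type*} [Ring A] [Algebra ℂ A] (W : Submodule ℂ A) (k : ℕ)
    (x : A) : (-1 : A) ^ k * x ∈ W ↔ x ∈ W := by
  rcases neg_one_pow_eq_or A k with h | h <;> simp [h]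

lemma neg_one_pow_mul_sub_mem_iff {A : Type*} [Ring A] [Algebra ℂ A] (W : Submodule ℂ A) (k : ℕ)
    {x y : A} : (-1 : A) ^ k * x - y ∈ W ↔ x - (-1 : A) ^ k * y ∈ W := by
  rcases neg_one_pow_eq_or A k with h | h
  · simp [h]
  · rw [← neg_mem_iff, h]
    simp [add_comm]

lemma exists_sub_smul_mem_of_sign {A : Type*} [Ring A] [Algebra ℂ A] (W : Submodule ℂ A) {k : ℕ}
    {x y : A} (h : x - (-1 : A) ^ k * y ∈ W) : ∃ c : ℂ, x - c • y ∈ W := by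
  rcases neg_one_pow_eq_or A k with hk | hk <;> rw [hk] at h
  · exact ⟨1, by simpa using h⟩
  · exact ⟨-1, by simpa using h⟩

lemma mem_of_sub_neg_one_pow_mul_mem {A : Type*} [Ring A] [Algebra ℂ A] (W : Submodule ℂ A) {k : ℕ}
    (hk : Odd k) {x : A} (h : x - (-1 : A) ^ k * x ∈ W) : x ∈ W := by
  rw [hk.neg_one_pow, neg_one_mul, sub_neg_eq_add, ← two_smul ℂ x] at h
  exact (Submodule.smul_mem_iff _ two_ne_zero).1 h

lemma boole_mul_sub_sub_mul_boole {A : Type*} [Ring A] (P Q R : Prop) [Decidable P] [Decidable Q]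
    [Decidable R] (x y : A) :
    (if P then 1 else 0) * ((if R ∧ Q then 1 else 0) - x) -
        ((if R ∧ P then 1 else 0) - y) * (if Q then 1 else 0) =
      (if Q then 1 else 0) * y - (if P then 1 else 0) * x := by
  by_cases hP : P <;> by_cases hQ : Q <;> by_cases hR : R <;> (simp [hP, hQ, hR]; try abel)

lemma neg_one_pow_mul_sub_of_even {A : Type*} [Ring A] (P : Prop) [Decidable P] {k : ℕ}
    (hk : P → Even k) (x y : A) :
    (-1) ^ k * (x * ((if P then 1 else 0) - y)) - ((if P then 1 else 0) - y) * x =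
      -((-1) ^ k * (x * y) - y * x) := by
  by_cases hP : P
  · rw [(hk hP).neg_one_pow, if_pos hP]
    noncomm_ring
  · simp [hP, add_comm, sub_eq_add_neg]

lemma ite_mul_mem {A : Type*} [Ring A] [Algebra ℂ A] (W : Submodule ℂ A) (P : Prop) [Decidable P]
    {x : A} (hx : x ∈ W) : (if P then (1 : A) else 0) * x ∈ W := by
  split_ifs <;> simp [hx]

lemma quotD_tc_succ (i j : Fin (m + n)) (r : ℕ) :
    quotD m n (tc m n i j (r + 1)) = genD m n (Sum.inl (i, j, r)) := rfl

lemma quotD_tc_zero (i j : Fin (m + n)) :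
    quotD m n (tc m n i j 0) = if i = j then 1 else 0 := by
  simp only [tc]
  split_ifs <;> simp

lemma quotD_tdc (i j : Fin (m + n)) (s : ℕ) :
    quotD m n (tdc m n i j s) =
      (if s = 0 ∧ i = j then 1 else 0) - genD m n (Sum.inr (i, j, s)) := by
  rw [tdc, map_sub]
  congr 1
  split_ifs <;> simp

lemma tc_mul_tc_mem (i j k l : Fin (m + n)) (a b : ℕ) :
    quotD m n (tc m n k j a) * quotD m n (tc m n i l (b + 1)) ∈ lowerDY m n (a + b) ∧
    quotD m n (tc m n k j (b + 1)) * quotD m n (tc m n i l a) ∈ lowerDY m n (a + b) := by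
  simp only [quotD_tc_succ]
  cases a with
  | zero =>
    simp only [quotD_tc_zero]
    constructor
    · split_ifs
      · rw [one_mul]
        exact gen_mem_lowerSpan _ (by simp [degG])
      · simp
    · split_ifs
      · rw [mul_one]
        exact gen_mem_lowerSpan _ (by simp [degG])
      · simp
  | succ a =>
    simp only [quotD_tc_succ]
    constructor <;> exact gen_mul_gen_mem_lowerSpan _ _ (by simp only [degG]; push_cast; omega)

lemma yang_mem (i j k l : Fin (m + n)) (r s : ℕ) :
    genD m n (Sum.inl (i, j, r)) * genD m n (Sum.inl (k, l, s))
      - (-1) ^ ((par m i + par m j) * (par m k + par m l)) *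
        (genD m n (Sum.inl (k, l, s)) * genD m n (Sum.inl (i, j, r))) ∈
      lowerDY m n (r + s) := by
  have h := RingQuot.mkAlgHom_rel ℂ (DRel.yang i j k l r s)
  simp only [map_sub, map_mul, map_pow, map_neg, map_one, map_sum] at h
  change genD m n (Sum.inl (i, j, r)) * genD m n (Sum.inl (k, l, s))
      - (-1) ^ ((par m i + par m j) * (par m k + par m l)) *
        (genD m n (Sum.inl (k, l, s)) * genD m n (Sum.inl (i, j, r))) = _ at h
  rw [h, neg_one_pow_mul_mem_iff]
  refine sum_mem fun a ha => ?_
  have ha' := Finset.mem_range.1 ha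
  obtain ⟨b, hb⟩ : ∃ b, r + s + 1 - a = b + 1 := ⟨r + s - a, by omega⟩
  rw [hb]
  have hd : ((a : ℤ) + b) = r + s := by omega
  rw [← hd]
  exact sub_mem (tc_mul_tc_mem i j k l a b).1 (tc_mul_tc_mem i j k l a b).2

lemma dual_mem (i j k l : Fin (m + n)) (r s : ℕ) :
    genD m n (Sum.inr (i, j, r)) * genD m n (Sum.inr (k, l, s))
      - (-1) ^ ((par m i + par m j) * (par m k + par m l)) *
        (genD m n (Sum.inr (k, l, s)) * genD m n (Sum.inr (i, j, r))) ∈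
      lowerDY m n (-((r : ℤ) + 1) + -((s : ℤ) + 1)) := by
  have h := RingQuot.mkAlgHom_rel ℂ (DRel.dual i j k l r s)
  simp only [map_sub, map_add, map_mul, map_pow, map_neg, map_one, map_sum] at h
  change genD m n (Sum.inr (i, j, r)) * genD m n (Sum.inr (k, l, s))
      - (-1) ^ ((par m i + par m j) * (par m k + par m l)) *
        (genD m n (Sum.inr (k, l, s)) * genD m n (Sum.inr (i, j, r))) = _ at h
  rw [h, neg_one_pow_mul_mem_iff]
  have hlin : ∀ (P : Prop) [Decidable P] (x y : Fin (m + n)),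
      quotD m n (if P then tdD m n x y (r + s + 2) else 0) ∈
        lowerDY m n (-((r : ℤ) + 1) + -((s : ℤ) + 1)) := by
    intro P _ x y
    split_ifs
    · exact gen_mem_lowerSpan (gen := genD m n) (Sum.inr (x, y, r + s + 1))
        (by simp only [degG]; push_cast; omega)
    · simp
  refine add_mem (sub_mem (hlin _ _ _) (hlin _ _ _)) (sum_mem fun a ha => ?_)
  have ha' := Finset.mem_range.1 ha
  obtain ⟨b, hb⟩ : ∃ b, r + s + 2 - a = b + 1 := ⟨r + s + 1 - a, by omega⟩
  rw [hb]
  refine sub_mem ?_ ?_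
  · exact gen_mul_gen_mem_lowerSpan (gen := genD m n) (Sum.inr (k, j, b)) (Sum.inr (i, l, a))
      (by simp only [degG]; omega)
  · exact gen_mul_gen_mem_lowerSpan (gen := genD m n) (Sum.inr (k, j, a)) (Sum.inr (i, l, b))
      (by simp only [degG]; omega)

lemma mixed_rhs_mem (i j k l : Fin (m + n)) (r s : ℕ) :
    quotD m n (tc m n k j r) * quotD m n (tdc m n i l s) -
      quotD m n (tdc m n k j s) * quotD m n (tc m n i l r) ∈ lowerDY m n ((r : ℤ) - s - 1) := by
  simp only [quotD_tdc]
  cases r with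
  | zero =>
    have hgen : ∀ x y : Fin (m + n),
        genD m n (Sum.inr (x, y, s)) ∈ lowerDY m n (((0 : ℕ) : ℤ) - s - 1) := fun x y =>
      gen_mem_lowerSpan _ (by simp only [degG]; push_cast; omega)
    simp only [quotD_tc_zero]
    rw [boole_mul_sub_sub_mul_boole]
    exact sub_mem (ite_mul_mem _ _ (hgen k j)) (ite_mul_mem _ _ (hgen i l))
  | succ r =>
    simp only [quotD_tc_succ]
    have hlin : ∀ (P : Prop) [Decidable P] (x y : Fin (m + n)),
        (if s = 0 ∧ P then (1 : DY m n) else 0) * genD m n (Sum.inl (x, y, r)) ∈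
          lowerDY m n (((r + 1 : ℕ) : ℤ) - s - 1) := by
      intro P _ x y
      split_ifs with h
      · rw [one_mul]
        exact gen_mem_lowerSpan _ (by simp only [degG]; push_cast; omega)
      · simp
    rw [mul_sub, sub_mul]
    refine sub_mem (sub_mem ?_ ?_) (sub_mem (hlin _ _ _) ?_)
    · rw [mul_ite, mul_one, mul_zero, ← boole_mul]
      exact hlin _ _ _
    all_goals exact gen_mul_gen_mem_lowerSpan _ _ (by simp only [degG]; push_cast; omega)

lemma quotD_Xmix_zero (i j k l : Fin (m + n)) (s : ℕ) :
    quotD m n (Xmix m n i j k l 0 s) = 0 := by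
  by_cases h : i = j
  · subst h
    simp [Xmix, tc, pow_add, ← two_mul, mul_assoc, pow_mul]
  · simp [Xmix, tc, h]

lemma quotD_Xmix_mem (i j k l : Fin (m + n)) (r s : ℕ) :
    quotD m n (Xmix m n i j k l r s) ∈ lowerDY m n ((r : ℤ) - s - 2) := by
  induction r generalizing s with
  | zero => rw [quotD_Xmix_zero]; exact zero_mem _
  | succ r ih =>
    have h := RingQuot.mkAlgHom_rel ℂ (DRel.mixed i j k l r s)
    simp only [map_sub, map_mul, map_pow, map_neg, map_one] at h
    rw [sub_eq_iff_eq_add] at h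
    rw [quotD, h]
    refine add_mem ?_ ?_
    · rw [neg_one_pow_mul_mem_iff]
      exact lowerDY_mono (by push_cast; omega) (mixed_rhs_mem i j k l r s)
    · split_ifs with hs
      · simp
      · exact lowerDY_mono (by push_cast; omega) (ih (s - 1))

lemma mixed_mem (i j k l : Fin (m + n)) (r s : ℕ) :
    (-1) ^ ((par m i + par m j) * (par m k + par m l)) *
        (genD m n (Sum.inl (i, j, r)) * genD m n (Sum.inr (k, l, s)))
      - genD m n (Sum.inr (k, l, s)) * genD m n (Sum.inl (i, j, r)) ∈
      lowerDY m n ((r : ℤ) + -((s : ℤ) + 1)) := by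
  have h := quotD_Xmix_mem i j k l (r + 1) s
  simp only [Xmix, map_sub, map_mul, map_pow, map_neg, map_one] at h
  rw [pow_add, mul_assoc, ← mul_sub, neg_one_pow_mul_mem_iff, quotD_tdc,
    quotD_tc_succ] at h
  have hd : ((r + 1 : ℕ) : ℤ) - s - 2 = r + -((s : ℤ) + 1) := by push_cast; ring
  rwa [hd, neg_one_pow_mul_sub_of_even _ fun hkl => hkl.2 ▸ Even.mul_left (Even.add_self _) _,
    neg_mem_iff] at h

lemma exists_comm_mem_lowerDY (g h : GD m n) : ∃ c : ℂ,
    genD m n g * genD m n h - c • (genD m n h * genD m n g) ∈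
      lowerDY m n (degG m n g + degG m n h) := by
  rcases g with ⟨i, j, r⟩ | ⟨i, j, r⟩ <;> rcases h with ⟨k, l, s⟩ | ⟨k, l, s⟩
  · exact exists_sub_smul_mem_of_sign _ (yang_mem i j k l r s)
  · have h := mixed_mem i j k l r s
    exact exists_sub_smul_mem_of_sign _ (neg_one_pow_mul_sub_mem_iff _ _ |>.1 h)
  · have h := neg_mem (mixed_mem k l i j s r)
    rw [neg_sub, add_comm] at h
    exact exists_sub_smul_mem_of_sign _ h
  · exact exists_sub_smul_mem_of_sign _ (dual_mem i j k l r s)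

lemma par_add_mul_self_odd {i j : Fin (m + n)} (h : par m i ≠ par m j) :
    Odd ((par m i + par m j) * (par m i + par m j)) := by
  unfold par at *
  split_ifs at * <;> simp_all

lemma sq_mem_lowerDY (g : GD m n) (hg : isOddD m n g) :
    genD m n g * genD m n g ∈ lowerDY m n (degG m n g + degG m n g) := by
  rcases g with ⟨i, j, r⟩ | ⟨i, j, r⟩
  · exact mem_of_sub_neg_one_pow_mul_mem _ (par_add_mul_self_odd hg) (yang_mem i j i j r r)
  · exact mem_of_sub_neg_one_pow_mul_mem _ (par_add_mul_self_odd hg) (dual_mem i j i j r r)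

lemma mem_span_monoD (x : DY m n) : x ∈ Submodule.span ℂ (Set.range (monoD m n)) := by
  obtain ⟨a, rfl⟩ := RingQuot.mkAlgHom_surjective ℂ (DRel m n) x
  have ha : a ∈ Subalgebra.toSubmodule (Algebra.adjoin ℂ (Set.range (FreeAlgebra.ι ℂ))) := by
    rw [FreeAlgebra.adjoin_range_ι]
    trivial
  rw [Algebra.adjoin_eq_span] at ha
  refine (Submodule.span_le (p := (Submodule.span ℂ (Set.range (monoD m n))).comap
    (quotD m n).toLinearMap)).2 ?_ ha
  intro b hb
  rw [← FreeMonoid.mrange_lift] at hb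
  obtain ⟨l, rfl⟩ := hb
  refine Submodule.subset_span ⟨l.toList, ?_⟩
  simp [monoD, FreeMonoid.lift_apply, map_list_prod, Function.comp_def]
  rfl

end Relations

section Order

variable {m n : ℕ}

lemma leG_total (g h : GD m n) : leG m n g h ∨ leG m n h g := by
  rcases g with ⟨i, j, r⟩ | ⟨i, j, r⟩ <;> rcases h with ⟨k, l, s⟩ | ⟨k, l, s⟩ <;>
    simp only [leG, lexLT, Prod.mk.injEq, or_true, true_or] <;> omega

lemma leG_trans {f g h : GD m n} (hfg : leG m n f g) (hgh : leG m n g h) : leG m n f h := by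
  rcases f with ⟨i, j, r⟩ | ⟨i, j, r⟩ <;> rcases g with ⟨k, l, s⟩ | ⟨k, l, s⟩ <;>
    rcases h with ⟨x, y, t⟩ | ⟨x, y, t⟩ <;>
    simp only [leG, lexLT, Prod.mk.injEq] at * <;> omega

instance : LawfulBEq (GD m n) where
  rfl {g} := by
    rcases g with g | g <;> exact beq_self_eq_true g
  eq_of_beq {g h} hgh := by
    rcases g with g | g <;> rcases h with h | h
    · exact congrArg Sum.inl (eq_of_beq (a := g) (b := h) hgh)
    · exact absurd hgh Bool.false_ne_true
    · exact absurd hgh Bool.false_ne_true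
    · exact congrArg Sum.inr (eq_of_beq (a := g) (b := h) hgh)

end Order

theorem statement13 (m n : ℕ) (hN : 1 ≤ m + n) (hmn : m ≠ n) :
    ∀ (x : DY m n) (p : ℤ),
      ∃ y ∈ Submodule.span ℂ {z | ∃ l : List (GD m n), OrderedMonomialD m n l ∧ z = monoD m n l},
        x - y ∈ Fil m n p := by
  intro x p
  classical
  have : Std.Total (leG m n) := ⟨leG_total⟩
  have : IsTrans (GD m n) (leG m n) := ⟨fun _ _ _ => leG_trans⟩
  have hmono (l : List (GD m n)) := prod_mem_ordered_sup_filtration (gen := genD m n)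
    (deg := degG m n) (leG m n) (isOddD m n) exists_comm_mem_lowerDY sq_mem_lowerDY p l
  suffices hx : x ∈ Submodule.span ℂ
      {z | ∃ l : List (GD m n), OrderedMonomialD m n l ∧ z = monoD m n l} ⊔ Fil m n p by
    obtain ⟨y, hy, z, hz, rfl⟩ := Submodule.mem_sup.1 hx
    exact ⟨y, hy, by simpa using hz⟩
  have hspan := mem_span_monoD x
  refine Submodule.span_le.2 ?_ hspan
  rintro _ ⟨l, rfl⟩
  exact hmono l
end
end

section
/- The ordered monomials in the generators t_{ij}^{(r)}, t_{ij}^{(−r)} form a ℂ-linearly independent family in DY₀(gl_{m|n}): every finite ℂ-linear combination of pairwise distinct ordered monomials that vanishes in DY₀(gl_{m|n}) has all coefficients equal to zero. -/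
/-!
The level-0 double Yangian DY₀(gl_{m|n}), presented by generators and relations.
Generators: `Sum.inl (i,j,r)` represents t_{ij}^{(r+1)}, `Sum.inr (i,j,r)` represents
t_{ij}^{(−(r+1))}.  The relations are (a) the Yangian relations, (b) the dual Yangian
relations, and (c) the mixed relations obtained by equating coefficients of u^{−r} v^{s}
and matrix units in
  (u−v)(T₁(u) T₂⁺(v) − T₂⁺(v) T₁(u)) = P T₁(u) T₂⁺(v) − T₂⁺(v) T₁(u) P.
Computing the matrix entry at e_{ij} ⊗ e_{kl} of both sides of this identity in the
graded tensor product (End V) ⊗ (End V) ⊗ A (Koszul signs included) yields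
  (u−v)·((−1)^{A+pq} t_{ij}(u)t⁺_{kl}(v) − (−1)^{A} t⁺_{kl}(v)t_{ij}(u))
    = (−1)^{B} (t_{kj}(u)t⁺_{il}(v) − t⁺_{kj}(v)t_{il}(u)),
with A = ī j̄ + j̄ + k̄ l̄ + l̄, p = ī+j̄, q = k̄+l̄, B = j̄ + l̄ + ī l̄ + k̄ l̄ + j̄ l̄;
the constructor `mixed` below is the coefficient of u^{−r} v^{s} of this identity.
(The coefficients of positive powers of u vanish identically.)
-/

noncomputable section

namespace DoubleYangian

open PowerSeries

/-- Signs only depend on the exponent modulo two. -/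
lemma sign_congr {a b : ℕ} (h : (a : ZMod 2) = b) : (-1 : ℤ) ^ a = (-1) ^ b := by
  rw [ZMod.natCast_eq_natCast_iff] at h
  rw [neg_one_pow_eq_pow_mod_two, h, ← neg_one_pow_eq_pow_mod_two]

lemma neg_one_pow_mul_eq_zsmul {R : Type*} [Ring R] (k : ℕ) (x : R) :
    (-1 : R) ^ k * x = (-1 : ℤ) ^ k • x := by
  simp [zsmul_eq_mul]

section Exchange

variable {D I : Type*} [Ring D]

/-- The exchange relation `z [L, M] = w (L M - M L)` of two matrices of generating series,
with the signs dictated by the parities `p`. -/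
def Exchange (p : I → ℕ) (z w : D) (L M : I → I → D) : Prop :=
  ∀ i j k l,
    z * (L i j * M k l - (-1 : ℤ) ^ ((p i + p j) * (p k + p l)) • (M k l * L i j)) =
      (-1 : ℤ) ^ (p i * p j + p i * p k + p j * p k) •
        (w * (L k j * M i l - M k j * L i l))

/-- Entries of `F` and `G` commute in the graded sense. -/
def SuperCommute (p : I → ℕ) (F G : I → I → D) : Prop :=
  ∀ i j k l, F i j * G k l = (-1 : ℤ) ^ ((p i + p j) * (p k + p l)) • (G k l * F i j)

lemma exchange_product_term {z w A B C E X Y : D} {e₁ e₂ e₃ e₄ e₅ : ℤ}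
    (hz : ∀ x : D, z * x = x * z) (hw : ∀ x : D, w * x = x * w)
    (hBC : B * C = e₁ • (C * B)) (hEA : E * A = e₂ • (A * E))
    (hAC : z * (A * C - e₃ • (C * A)) = w * X)
    (hBE : z * (B * E - e₄ • (E * B)) = w * Y)
    (he : e₁ * e₃ * e₄ = e₅ * e₂) :
    z * (A * B * (C * E) - e₅ • (C * E * (A * B))) =
      e₁ • (w * (X * (B * E))) + (e₁ * e₃) • (w * (C * A * Y)) := by
  have h1 : A * B * (C * E) = e₁ • (A * C * (B * E)) := by
    rw [show A * B * (C * E) = A * (B * C) * E by noncomm_ring, hBC]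
    simp only [mul_smul_comm, smul_mul_assoc, mul_assoc]
  have h2 : C * E * (A * B) = e₂ • (C * A * (E * B)) := by
    rw [show C * E * (A * B) = C * (E * A) * B by noncomm_ring, hEA]
    simp only [mul_smul_comm, smul_mul_assoc, mul_assoc]
  have h3 : w * (X * (B * E)) = z * ((A * C) * (B * E)) - e₃ • (z * (C * A * (B * E))) := by
    rw [← mul_assoc w, ← hAC]
    simp only [mul_sub, sub_mul, mul_smul_comm, smul_mul_assoc, mul_assoc]
  have h4 : w * (C * A * Y) = z * (C * A * (B * E)) - e₄ • (z * (C * A * (E * B))) := by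
    rw [← mul_assoc w, hw (C * A), mul_assoc (C * A), ← hBE, ← mul_assoc, ← hz, mul_assoc]
    simp only [mul_sub, mul_smul_comm]
  rw [h1, h2, h3, h4]
  simp only [mul_sub, smul_sub, mul_smul_comm, smul_smul, he]
  abel

/-- The exchange relation is multiplicative. -/
lemma Exchange.mul [Fintype I] {p : I → ℕ} {z w : D} {L M L' M' : I → I → D}
    (hz : ∀ x : D, z * x = x * z) (hw : ∀ x : D, w * x = x * w)
    (h : Exchange p z w L M) (h' : Exchange p z w L' M')
    (hLM : SuperCommute p L' M) (hML : SuperCommute p M' L) :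
    Exchange p z w (fun i j => ∑ a, L i a * L' a j) (fun k l => ∑ b, M k b * M' b l) := by
  intro i j k l
  set E1 : I → I → D := fun a b =>
    (-1 : ℤ) ^ (p i * p j + p i * p k + p j * p k + (p a + p j) * (p i + p b)) •
      (w * (L k a * M i b * (L' a j * M' b l))) with hE1
  set E2 : I → I → D := fun a b =>
    (-1 : ℤ) ^ ((p a + p j) * (p k + p b) + (p i * p a + p i * p k + p a * p k)) •
      (w * (M k a * L i b * (L' a j * M' b l))) with hE2
  set E3 : I → I → D := fun a b =>
    (-1 : ℤ) ^ (p i * p j + p i * p k + p j * p k + (p a + p j) * (p i + p b)) •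
      (w * (M k a * L i b * (M' a j * L' b l))) with hE3
  have hterm : ∀ a b,
      z * (L i a * L' a j * (M k b * M' b l) - (-1 : ℤ) ^ ((p i + p j) * (p k + p l)) •
        (M k b * M' b l * (L i a * L' a j))) = E1 a b - E2 a b + E2 b a - E3 b a := by
    intro a b
    have h1 := (h i a k b).trans (mul_smul_comm _ _ _).symm
    have h2 := (h' a j b l).trans (mul_smul_comm _ _ _).symm
    rw [exchange_product_term hz hw (hLM a j k b) (hML b l i a) h1 h2]
    · simp only [hE1, hE2, hE3, smul_sub, mul_sub, sub_mul, smul_mul_assoc, mul_smul_comm,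
        smul_smul, ← pow_add]
      have s1 : (-1 : ℤ) ^ ((p a + p j) * (p k + p b) + (p i * p a + p i * p k + p a * p k)) =
          (-1) ^ (p i * p j + p i * p k + p j * p k + (p a + p j) * (p i + p b)) := by
        apply sign_congr
        push_cast
        generalize (p i : ZMod 2) = x1
        generalize (p j : ZMod 2) = x2
        generalize (p k : ZMod 2) = x3
        generalize (p a : ZMod 2) = x5
        generalize (p b : ZMod 2) = x6
        revert x1 x2 x3 x5 x6
        decide
      have s2 : (-1 : ℤ) ^ ((p a + p j) * (p k + p b) + (p i + p a) * (p k + p b) +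
            (p a * p j + p a * p b + p j * p b)) =
          (-1) ^ ((p b + p j) * (p k + p a) + (p i * p b + p i * p k + p b * p k)) := by
        apply sign_congr
        push_cast
        generalize (p i : ZMod 2) = x1
        generalize (p j : ZMod 2) = x2
        generalize (p k : ZMod 2) = x3
        generalize (p a : ZMod 2) = x5
        generalize (p b : ZMod 2) = x6
        revert x1 x2 x3 x5 x6
        decide
      have s3 : (-1 : ℤ) ^ ((p b + p j) * (p k + p a) + (p i * p b + p i * p k + p b * p k)) =
          (-1) ^ (p i * p j + p i * p k + p j * p k + (p b + p j) * (p i + p a)) := by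
        apply sign_congr
        push_cast
        generalize (p i : ZMod 2) = x1
        generalize (p j : ZMod 2) = x2
        generalize (p k : ZMod 2) = x3
        generalize (p a : ZMod 2) = x5
        generalize (p b : ZMod 2) = x6
        revert x1 x2 x3 x5 x6
        decide
      rw [s2, s1, s3]
      simp only [mul_assoc]
      abel
    · simp only [← pow_add]
      apply sign_congr
      push_cast
      generalize (p i : ZMod 2) = x1
      generalize (p j : ZMod 2) = x2
      generalize (p k : ZMod 2) = x3
      generalize (p l : ZMod 2) = x4
      generalize (p a : ZMod 2) = x5
      generalize (p b : ZMod 2) = x6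
      revert x1 x2 x3 x4 x5 x6
      decide
  have hL : z * ((∑ a, L i a * L' a j) * (∑ b, M k b * M' b l) -
      (-1 : ℤ) ^ ((p i + p j) * (p k + p l)) •
        ((∑ b, M k b * M' b l) * ∑ a, L i a * L' a j)) =
      ∑ a, ∑ b, (E1 a b - E2 a b + E2 b a - E3 b a) := by
    simp only [← hterm]
    rw [Finset.sum_mul_sum, Finset.sum_mul_sum,
      Finset.sum_comm (f := fun b a => M k b * M' b l * (L i a * L' a j)), Finset.smul_sum,
      ← Finset.sum_sub_distrib, Finset.mul_sum]
    refine Finset.sum_congr rfl fun a _ => ?_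
    rw [Finset.smul_sum, ← Finset.sum_sub_distrib, Finset.mul_sum]
  have hR : (-1 : ℤ) ^ (p i * p j + p i * p k + p j * p k) •
      (w * ((∑ a, L k a * L' a j) * (∑ b, M i b * M' b l) -
        (∑ a, M k a * M' a j) * ∑ b, L i b * L' b l)) =
      ∑ a, ∑ b, (E1 a b - E3 a b) := by
    rw [Finset.sum_mul_sum, Finset.sum_mul_sum, ← Finset.sum_sub_distrib, Finset.mul_sum,
      Finset.smul_sum]
    refine Finset.sum_congr rfl fun a _ => ?_
    rw [← Finset.sum_sub_distrib, Finset.mul_sum, Finset.smul_sum]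
    refine Finset.sum_congr rfl fun b _ => ?_
    have h1 : L k a * L' a j * (M i b * M' b l) =
        (-1 : ℤ) ^ ((p a + p j) * (p i + p b)) • (L k a * M i b * (L' a j * M' b l)) := by
      rw [show L k a * L' a j * (M i b * M' b l) = L k a * (L' a j * M i b) * M' b l by
        noncomm_ring, hLM a j i b]
      simp only [mul_smul_comm, smul_mul_assoc, mul_assoc]
    have h2 : M k a * M' a j * (L i b * L' b l) =
        (-1 : ℤ) ^ ((p a + p j) * (p i + p b)) • (M k a * L i b * (M' a j * L' b l)) := by
      rw [show M k a * M' a j * (L i b * L' b l) = M k a * (M' a j * L i b) * L' b l by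
        noncomm_ring, hML a j i b]
      simp only [mul_smul_comm, smul_mul_assoc, mul_assoc]
    simp only [hE1, hE3]
    rw [h1, h2, mul_sub, smul_sub, mul_smul_comm, mul_smul_comm, smul_smul, smul_smul, ← pow_add]
  rw [hL, hR]
  simp only [Finset.sum_sub_distrib, Finset.sum_add_distrib]
  rw [Finset.sum_comm (f := fun a b => E2 b a), Finset.sum_comm (f := fun a b => E3 b a)]
  abel

/-- The exchange relation for the evaluation matrices `1 + e(u)`, `1 + e(v)`. -/
lemma exchange_evaluation [DecidableEq I] {p : I → ℕ} {z w : D} {e e' h : I → I → D}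
    (he : ∀ i j k l, e i j * e' k l = if j = k then (-1 : ℤ) ^ p j • h i l else 0)
    (he' : ∀ i j k l, e' i j * e k l = if j = k then (-1 : ℤ) ^ p j • h i l else 0)
    (hz : ∀ i l, z * h i l = w * (e' i l - e i l)) :
    Exchange p z w (fun i j => (if i = j then 1 else 0) + e i j)
      (fun i j => (if i = j then 1 else 0) + e' i j) := by
  intro i j k l
  have h1 : ((if i = j then 1 else 0) + e i j) * ((if k = l then 1 else 0) + e' k l) -
      (-1 : ℤ) ^ ((p i + p j) * (p k + p l)) •
        (((if k = l then 1 else 0) + e' k l) * ((if i = j then 1 else 0) + e i j)) =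
      e i j * e' k l - (-1 : ℤ) ^ ((p i + p j) * (p k + p l)) • (e' k l * e i j) := by
    by_cases hij : i = j
    · have : (-1 : ℤ) ^ ((p i + p j) * (p k + p l)) = 1 := by
        subst hij; exact Even.neg_one_pow (by simp [← two_mul, mul_assoc])
      rw [this]
      by_cases hkl : k = l
      · simp [hij, hkl, mul_add, add_mul]
        abel
      · simp [hij, hkl, mul_add, add_mul]
    · by_cases hkl : k = l
      · have : (-1 : ℤ) ^ ((p i + p j) * (p k + p l)) = 1 := by
          subst hkl
          exact Even.neg_one_pow (by
            rw [← two_mul, mul_comm, mul_assoc]; exact even_two_mul _)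
        rw [this]
        simp [hij, hkl, mul_add, add_mul]
      · simp [hij, hkl]
  have h2 : ((if k = j then 1 else 0) + e k j) * ((if i = l then 1 else 0) + e' i l) -
      ((if k = j then 1 else 0) + e' k j) * ((if i = l then 1 else 0) + e i l) =
      (if j = k then e' i l - e i l else 0) - (if l = i then e' k j - e k j else 0) := by
    simp only [add_mul, mul_add, he, he', eq_comm (a := k) (b := j), eq_comm (a := i) (b := l)]
    split_ifs <;> simp <;> abel
  rw [h1, h2, he, he', mul_sub, mul_sub, smul_sub]
  congr 1
  · split_ifs with hjk
    · rw [mul_smul_comm, hz]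
      congr 1
      apply sign_congr
      subst hjk
      push_cast
      generalize (p i : ZMod 2) = x1
      generalize (p j : ZMod 2) = x2
      revert x1 x2
      decide
    · simp
  · split_ifs with hli
    · rw [mul_smul_comm, mul_smul_comm, hz, smul_smul, ← pow_add]
      congr 1
      apply sign_congr
      subst hli
      push_cast
      generalize (p l : ZMod 2) = x1
      generalize (p j : ZMod 2) = x2
      generalize (p k : ZMod 2) = x3
      revert x1 x2 x3
      decide
    · simp

end Exchange

section TwoVariables

variable {C : Type*} [Ring C]

/-- A series in the first variable. -/
def fstVar (A : C⟦X⟧) : C⟦X⟧⟦X⟧ := PowerSeries.C A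

/-- A series in the second variable. -/
def sndVar (B : C⟦X⟧) : C⟦X⟧⟦X⟧ := PowerSeries.map PowerSeries.C B

/-- The coefficient of a series in two variables. -/
def coeff₂ (a b : ℕ) : C⟦X⟧⟦X⟧ →+ C :=
  (PowerSeries.coeff a).toAddMonoidHom.comp (PowerSeries.coeff b).toAddMonoidHom

/-- The first variable. -/
def x₁ : C⟦X⟧⟦X⟧ := PowerSeries.C X

/-- The second variable. -/
def x₂ : C⟦X⟧⟦X⟧ := X

lemma coeff₂_apply (a b : ℕ) (F : C⟦X⟧⟦X⟧) : coeff₂ a b F = coeff a (coeff b F) := rfl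

lemma ext₂ {F G : C⟦X⟧⟦X⟧} (h : ∀ a b, coeff₂ a b F = coeff₂ a b G) : F = G :=
  PowerSeries.ext fun b => PowerSeries.ext fun a => h a b

lemma coeff₂_fst_mul_snd (a b : ℕ) (A B : C⟦X⟧) :
    coeff₂ a b (fstVar A * sndVar B) = coeff a A * coeff b B := by
  simp [coeff₂_apply, fstVar, sndVar, coeff_C_mul, coeff_mul_C]

lemma coeff₂_snd_mul_fst (a b : ℕ) (A B : C⟦X⟧) :
    coeff₂ a b (sndVar B * fstVar A) = coeff b B * coeff a A := by
  simp [coeff₂_apply, fstVar, sndVar, coeff_C_mul, coeff_mul_C]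

lemma coeff₂_fst (a b : ℕ) (A : C⟦X⟧) :
    coeff₂ a b (fstVar A) = if b = 0 then coeff a A else 0 := by
  simp only [coeff₂_apply, fstVar, coeff_C]
  split_ifs <;> simp

lemma coeff₂_snd (a b : ℕ) (B : C⟦X⟧) :
    coeff₂ a b (sndVar B) = if a = 0 then coeff b B else 0 := by
  simp only [coeff₂_apply, sndVar, coeff_map, coeff_C]

@[simp] lemma coeff₂_succ_x₁_mul (a b : ℕ) (F : C⟦X⟧⟦X⟧) :
    coeff₂ (a + 1) b (x₁ * F) = coeff₂ a b F := by
  simp [coeff₂_apply, x₁, coeff_C_mul, coeff_succ_X_mul]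

@[simp] lemma coeff₂_zero_x₁_mul (b : ℕ) (F : C⟦X⟧⟦X⟧) : coeff₂ 0 b (x₁ * F) = 0 := by
  simp [coeff₂_apply, x₁, coeff_C_mul]

@[simp] lemma coeff₂_succ_x₂_mul (a b : ℕ) (F : C⟦X⟧⟦X⟧) :
    coeff₂ a (b + 1) (x₂ * F) = coeff₂ a b F := by
  simp [coeff₂_apply, x₂, coeff_succ_X_mul]

@[simp] lemma coeff₂_zero_x₂_mul (a : ℕ) (F : C⟦X⟧⟦X⟧) : coeff₂ a 0 (x₂ * F) = 0 := by
  simp [coeff₂_apply, x₂]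

lemma x₁_comm (F : C⟦X⟧⟦X⟧) : x₁ * F = F * x₁ := by
  refine PowerSeries.ext fun b => ?_
  simp only [x₁, coeff_C_mul, coeff_mul_C]
  exact (commute_X _).symm

lemma x₂_comm (F : C⟦X⟧⟦X⟧) : x₂ * F = F * x₂ := (commute_X F).symm

end TwoVariables

section Transfer

variable {C I : Type*} [Ring C]

/-- The matrix `1 + e`. -/
def onePlus [DecidableEq I] (e : I → I → C⟦X⟧) (i j : I) : C⟦X⟧ := (if i = j then 1 else 0) + e i j

/-- The product `(1 + e 0) (1 + e 1) ⋯ (1 + e (d - 1))`. -/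
def transfer [Fintype I] [DecidableEq I] (e : ℕ → I → I → C⟦X⟧) : ℕ → I → I → C⟦X⟧
  | 0 => fun i j => if i = j then 1 else 0
  | d + 1 => fun i j => ∑ k, transfer e d i k * onePlus (e d) k j

/-- Entries of `F` and `G` commute coefficientwise in the graded sense. -/
def CoeffSuperCommute (p : I → ℕ) (F G : I → I → C⟦X⟧) : Prop :=
  ∀ i j k l a b, coeff a (F i j) * coeff b (G k l) =
    (-1 : ℤ) ^ ((p i + p j) * (p k + p l)) • (coeff b (G k l) * coeff a (F i j))

variable {p : I → ℕ}

lemma CoeffSuperCommute.symm {F G : I → I → C⟦X⟧} (h : CoeffSuperCommute p F G) :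
    CoeffSuperCommute p G F := by
  intro i j k l a b
  rw [h k l i j b a, smul_smul, mul_comm (p k + p l), ← pow_add, ← two_mul]
  simp

lemma coeffSuperCommute_one [DecidableEq I] (G : I → I → C⟦X⟧) :
    CoeffSuperCommute p (fun i j => if i = j then 1 else 0) G := by
  intro i j k l a b
  by_cases hij : i = j
  · have : (-1 : ℤ) ^ ((p i + p j) * (p k + p l)) = 1 := by
      subst hij; exact Even.neg_one_pow (by simp [← two_mul, mul_assoc])
    rw [this]
    simp [hij, coeff_one]
  · simp [hij]

lemma CoeffSuperCommute.onePlus [DecidableEq I] {F G : I → I → C⟦X⟧} (h : CoeffSuperCommute p F G) :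
    CoeffSuperCommute p (onePlus F) G := by
  intro i j k l a b
  have h1 := coeffSuperCommute_one (p := p) G i j k l a b
  rw [DoubleYangian.onePlus, map_add, add_mul, mul_add (coeff b (G k l)), smul_add,
    h i j k l a b]
  exact congrArg (· + _) h1

lemma CoeffSuperCommute.mul [Fintype I] {F F' G : I → I → C⟦X⟧} (h : CoeffSuperCommute p F G)
    (h' : CoeffSuperCommute p F' G) :
    CoeffSuperCommute p (fun i j => ∑ k, F i k * F' k j) G := by
  intro i j k l a b
  simp only [map_sum, coeff_mul, Finset.sum_mul, Finset.mul_sum, Finset.smul_sum]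
  refine Finset.sum_congr rfl fun c _ => Finset.sum_congr rfl fun x _ => ?_
  rw [mul_assoc, h' c j k l x.2 b, mul_smul_comm, ← mul_assoc, h i c k l x.1 b, smul_mul_assoc,
    smul_smul, ← pow_add, mul_assoc]
  congr 1
  apply sign_congr
  push_cast
  generalize (p i : ZMod 2) = x1
  generalize (p j : ZMod 2) = x2
  generalize (p k : ZMod 2) = x3
  generalize (p l : ZMod 2) = x4
  generalize (p c : ZMod 2) = x5
  revert x1 x2 x3 x4 x5
  decide

lemma CoeffSuperCommute.transfer [Fintype I] [DecidableEq I] {e : ℕ → I → I → C⟦X⟧}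
    {G : I → I → C⟦X⟧} {d : ℕ}
    (h : ∀ s < d, CoeffSuperCommute p (e s) G) : CoeffSuperCommute p (transfer e d) G := by
  induction d with
  | zero => exact coeffSuperCommute_one G
  | succ d ih =>
    exact (ih fun s hs => h s (hs.trans d.lt_succ_self)).mul (h d d.lt_succ_self).onePlus

lemma CoeffSuperCommute.fst_snd {F G : I → I → C⟦X⟧} (h : CoeffSuperCommute p F G) :
    SuperCommute p (fun i j => fstVar (F i j)) (fun i j => sndVar (G i j)) := by
  intro i j k l
  refine ext₂ fun a b => ?_
  rw [map_zsmul, coeff₂_fst_mul_snd, coeff₂_snd_mul_fst, h]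

lemma CoeffSuperCommute.snd_fst {F G : I → I → C⟦X⟧} (h : CoeffSuperCommute p F G) :
    SuperCommute p (fun i j => sndVar (F i j)) (fun i j => fstVar (G i j)) := by
  intro i j k l
  refine ext₂ fun a b => ?_
  rw [map_zsmul, coeff₂_fst_mul_snd, coeff₂_snd_mul_fst, h]

lemma exchange_transfer [Fintype I] [DecidableEq I] {z w : C⟦X⟧⟦X⟧} {e e' : ℕ → I → I → C⟦X⟧}
    (hz : ∀ x, z * x = x * z) (hw : ∀ x, w * x = x * w)
    (he : ∀ s, Exchange p z w (fun i j => fstVar (onePlus (e s) i j))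
      (fun i j => sndVar (onePlus (e' s) i j)))
    (hc : ∀ s t, s ≠ t → CoeffSuperCommute p (e s) (e' t)) (d : ℕ) :
    Exchange p z w (fun i j => fstVar (transfer e d i j))
      (fun i j => sndVar (transfer e' d i j)) := by
  induction d with
  | zero =>
    have := exchange_evaluation (p := p) (z := z) (w := w) (e := fun _ _ : I => 0)
      (e' := fun _ _ => 0) (h := fun _ _ => 0) (by simp) (by simp) (by simp)
    have h1 : (fun i j : I => fstVar (transfer e 0 i j)) =
        fun i j => (if i = j then 1 else 0) + 0 := by
      funext i j
      simp only [transfer, fstVar]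
      split_ifs <;> simp
    have h2 : (fun i j : I => sndVar (transfer e' 0 i j)) =
        fun i j => (if i = j then 1 else 0) + 0 := by
      funext i j
      simp only [transfer, sndVar]
      split_ifs <;> simp
    rw [h1, h2]
    exact this
  | succ d ih =>
    have := ih.mul hz hw (he d)
      (CoeffSuperCommute.fst_snd (CoeffSuperCommute.onePlus (CoeffSuperCommute.symm
        (CoeffSuperCommute.transfer fun s hs => (hc d s hs.ne').symm))))
      (CoeffSuperCommute.snd_fst (CoeffSuperCommute.onePlus (CoeffSuperCommute.symm
        (CoeffSuperCommute.transfer fun s hs => hc s d hs.ne))))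
    simpa only [transfer, fstVar, sndVar, map_sum, map_mul] using this

end Transfer

section Loop

variable {C I : Type*} [Ring C]

/-- The series `∑ κ n • E (δ n) Xⁿ`. -/
def loopSeries (κ : ℕ → ℤ) (δ : ℕ → ℤ) (E : I → I → ℤ → C) (i j : I) : C⟦X⟧ :=
  PowerSeries.mk fun n => κ n • E i j (δ n)

/-- The expansion of `E / (u - a)` at infinity, in the variable `u⁻¹`. -/
def seriesAtInfty (E : I → I → ℤ → C) : I → I → C⟦X⟧ :=
  loopSeries (fun n => if n = 0 then 0 else 1) (fun n => n - 1) E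

/-- The expansion of `E / (u - a)` at zero, in the variable `u`. -/
def seriesAtZero (E : I → I → ℤ → C) : I → I → C⟦X⟧ :=
  loopSeries (fun _ => -1) (fun n => -n - 1) E

lemma coeff_seriesAtInfty (E : I → I → ℤ → C) (i j : I) (n : ℕ) :
    coeff n (seriesAtInfty E i j) = if n = 0 then 0 else E i j (n - 1) := by
  simp only [seriesAtInfty, loopSeries, coeff_mk]
  split_ifs <;> simp

lemma coeff_seriesAtZero (E : I → I → ℤ → C) (i j : I) (n : ℕ) :
    coeff n (seriesAtZero E i j) = -E i j (-n - 1) := by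
  simp [seriesAtZero, loopSeries, coeff_mk]

/-- The multiplication table of the loop algebra of matrix units, up to signs. -/
def LoopRelations [DecidableEq I] (p : I → ℕ) (E : I → I → ℤ → C) : Prop :=
  ∀ i j k l r q, E i j r * E k l q = if j = k then (-1 : ℤ) ^ p j • E i l (r + q) else 0

/-- The series in two variables obtained from a double sequence of coefficients. -/
def mk₂ (c : ℕ → ℕ → C) : C⟦X⟧⟦X⟧ := PowerSeries.mk fun b => PowerSeries.mk fun a => c a b

@[simp] lemma coeff₂_mk₂ (c : ℕ → ℕ → C) (a b : ℕ) : coeff₂ a b (mk₂ c) = c a b := by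
  simp [coeff₂_apply, mk₂]

variable [DecidableEq I] {p : I → ℕ}

lemma exchange_onePlus_loopSeries {z w : C⟦X⟧⟦X⟧} {E : I → I → ℤ → C} (hE : LoopRelations p E)
    {κ δ κ' δ' : ℕ → ℤ}
    (hz : ∀ i l, z * mk₂ (fun a b => (κ a * κ' b) • E i l (δ a + δ' b)) =
      w * (sndVar (loopSeries κ' δ' E i l) - fstVar (loopSeries κ δ E i l))) :
    Exchange p z w (fun i j => fstVar (onePlus (loopSeries κ δ E) i j))
      (fun i j => sndVar (onePlus (loopSeries κ' δ' E) i j)) := by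
  have h1 : (fun i j => fstVar (onePlus (loopSeries κ δ E) i j)) =
      fun i j => (if i = j then 1 else 0) + fstVar (loopSeries κ δ E i j) := by
    funext i j
    simp only [onePlus, fstVar, map_add]
    split_ifs <;> simp
  have h2 : (fun i j => sndVar (onePlus (loopSeries κ' δ' E) i j)) =
      fun i j => (if i = j then 1 else 0) + sndVar (loopSeries κ' δ' E i j) := by
    funext i j
    simp only [onePlus, sndVar, map_add]
    split_ifs <;> simp
  rw [h1, h2]
  refine exchange_evaluation (h := fun i l => mk₂ (fun a b => (κ a * κ' b) • E i l (δ a + δ' b)))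
    ?_ ?_ hz
  · intro i j k l
    refine ext₂ fun a b => ?_
    rw [coeff₂_fst_mul_snd, loopSeries, loopSeries, coeff_mk, coeff_mk, smul_mul_smul_comm, hE]
    split_ifs
    · rw [map_zsmul, coeff₂_mk₂, smul_comm]
    · simp
  · intro i j k l
    refine ext₂ fun a b => ?_
    rw [coeff₂_snd_mul_fst, loopSeries, loopSeries, coeff_mk, coeff_mk, smul_mul_smul_comm, hE]
    split_ifs
    · rw [map_zsmul, coeff₂_mk₂, smul_comm, mul_comm, add_comm]
    · simp

lemma exchange_infty_infty {E : I → I → ℤ → C} (hE : LoopRelations p E) :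
    Exchange p (x₂ - x₁) (x₁ * x₂) (fun i j => fstVar (onePlus (seriesAtInfty E) i j))
      (fun i j => sndVar (onePlus (seriesAtInfty E) i j)) := by
  refine exchange_onePlus_loopSeries hE fun i l => ext₂ fun a b => ?_
  rw [sub_mul, map_sub, mul_assoc]
  rcases a with _ | a
  · rcases b with _ | b <;> simp
  rcases b with _ | b
  · simp
  simp only [coeff₂_succ_x₂_mul, coeff₂_succ_x₁_mul, coeff₂_mk₂, map_sub, coeff₂_fst, coeff₂_snd,
    loopSeries, coeff_mk]
  rcases a with _ | a
  · rcases b with _ | b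
    · simp
    · simp
  · rcases b with _ | b
    · simp
    · simp
      rw [sub_eq_zero]
      congr 1
      ring

lemma exchange_zero_zero {E : I → I → ℤ → C} (hE : LoopRelations p E) :
    Exchange p (x₁ - x₂) 1 (fun i j => fstVar (onePlus (seriesAtZero E) i j))
      (fun i j => sndVar (onePlus (seriesAtZero E) i j)) := by
  refine exchange_onePlus_loopSeries hE fun i l => ext₂ fun a b => ?_
  rw [sub_mul, map_sub, one_mul, map_sub, coeff₂_fst, coeff₂_snd]
  rcases a with _ | a <;> rcases b with _ | b
  · simp [loopSeries]
  · simp [loopSeries]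
    congr 1
    ring
  · simp [loopSeries]
    congr 1
    ring
  · simp
    rw [sub_eq_zero]
    congr 1
    ring

lemma exchange_infty_zero {E : I → I → ℤ → C} (hE : LoopRelations p E) :
    Exchange p (1 - x₁ * x₂) x₁ (fun i j => fstVar (onePlus (seriesAtInfty E) i j))
      (fun i j => sndVar (onePlus (seriesAtZero E) i j)) := by
  refine exchange_onePlus_loopSeries hE fun i l => ext₂ fun a b => ?_
  rw [sub_mul, map_sub, one_mul, mul_assoc]
  rcases a with _ | a
  · simp
  rw [coeff₂_succ_x₁_mul, coeff₂_succ_x₁_mul, map_sub, coeff₂_fst, coeff₂_snd]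
  rcases a with _ | a <;> rcases b with _ | b
  · simp [loopSeries]
  · simp [loopSeries]
  · simp [loopSeries]
  · simp
    rw [neg_add_eq_zero]
    congr 1
    ring

end Loop

section Coefficients

variable {C I : Type*} [Ring C] [DecidableEq I] [Fintype I] {p : I → ℕ}

/-- Pairwise supercommuting copies of the loop relations. -/
structure LoopFamily (p : I → ℕ) (E : ℕ → I → I → ℤ → C) : Prop where
  relations : ∀ s, LoopRelations p (E s)
  superCommute : ∀ s t, s ≠ t → ∀ i j k l r q,
    E s i j r * E t k l q = (-1 : ℤ) ^ ((p i + p j) * (p k + p l)) • (E t k l q * E s i j r)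

lemma LoopFamily.coeffSuperCommute {E : ℕ → I → I → ℤ → C} (hE : LoopFamily p E)
    (κ δ κ' δ' : ℕ → ℤ) (s t : ℕ) (hst : s ≠ t) :
    CoeffSuperCommute p (loopSeries κ δ (E s)) (loopSeries κ' δ' (E t)) := by
  intro i j k l a b
  simp only [loopSeries, coeff_mk]
  rw [smul_mul_smul_comm, smul_mul_smul_comm, hE.superCommute s t hst, smul_comm, mul_comm (κ a)]

/-- The graded commutator of two matrix entries. -/
def superBracket (p : I → ℕ) (F G : I → I → C) (i j k l : I) : C :=
  F i j * G k l - (-1 : ℤ) ^ ((p i + p j) * (p k + p l)) • (G k l * F i j)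

/-- The right-hand side of the exchange relation. -/
def exchangeTerm (p : I → ℕ) (F G : I → I → C) (i j k l : I) : C :=
  (-1 : ℤ) ^ (p i * p j + p i * p k + p j * p k) • (F k j * G i l - G k j * F i l)

lemma Exchange.coeff₂_eq {z w : C⟦X⟧⟦X⟧} {L M : I → I → C⟦X⟧}
    (h : Exchange p z w (fun i j => fstVar (L i j)) (fun i j => sndVar (M i j))) (i j k l : I) :
    z * mk₂ (fun a b => superBracket p (fun i j => coeff a (L i j)) (fun i j => coeff b (M i j))
        i j k l) =
      w * mk₂ (fun a b => exchangeTerm p (fun i j => coeff a (L i j)) (fun i j => coeff b (M i j))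
        i j k l) := by
  have hl : mk₂ (fun a b => superBracket p (fun i j => coeff a (L i j))
      (fun i j => coeff b (M i j)) i j k l) = fstVar (L i j) * sndVar (M k l) -
      (-1 : ℤ) ^ ((p i + p j) * (p k + p l)) • (sndVar (M k l) * fstVar (L i j)) := by
    refine ext₂ fun a b => ?_
    rw [map_sub, map_zsmul, coeff₂_fst_mul_snd, coeff₂_snd_mul_fst, coeff₂_mk₂, superBracket]
  have hr : mk₂ (fun a b => exchangeTerm p (fun i j => coeff a (L i j))
      (fun i j => coeff b (M i j)) i j k l) = (-1 : ℤ) ^ (p i * p j + p i * p k + p j * p k) •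
      (fstVar (L k j) * sndVar (M i l) - sndVar (M k j) * fstVar (L i l)) := by
    refine ext₂ fun a b => ?_
    rw [map_zsmul, map_sub, coeff₂_fst_mul_snd, coeff₂_snd_mul_fst, coeff₂_mk₂, exchangeTerm]
  rw [hl, hr, mul_smul_comm]
  exact h i j k l

variable (E : ℕ → I → I → ℤ → C) (d : ℕ)

/-- The coefficients of the transfer matrix at infinity. -/
def yangCoeff (r : ℕ) (i j : I) : C := coeff r (transfer (fun s => seriesAtInfty (E s)) d i j)

/-- The coefficients of the transfer matrix at zero. -/
def dualCoeff (r : ℕ) (i j : I) : C := coeff r (transfer (fun s => seriesAtZero (E s)) d i j)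

variable {E}

lemma yangCoeff_zero (i j : I) : yangCoeff E d 0 i j = if i = j then 1 else 0 := by
  unfold yangCoeff
  induction d generalizing i j with
  | zero =>
    simp only [transfer]
    split_ifs <;> simp
  | succ d ih =>
    have h : ∀ k j, coeff 0 (onePlus (seriesAtInfty (E d)) k j) = if k = j then 1 else 0 := by
      intro k j
      rw [onePlus, map_add, coeff_seriesAtInfty, if_pos rfl, add_zero]
      split_ifs <;> simp
    simp only [transfer, map_sum, coeff_mul, Finset.Nat.antidiagonal_zero, Finset.sum_singleton,
      ih, h]
    simp

lemma yang_exchange (hE : LoopFamily p E) (i j k l : I) (r s : ℕ) :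
    superBracket p (yangCoeff E d (r + 1)) (yangCoeff E d s) i j k l -
      superBracket p (yangCoeff E d r) (yangCoeff E d (s + 1)) i j k l =
      exchangeTerm p (yangCoeff E d r) (yangCoeff E d s) i j k l := by
  have h := exchange_transfer (p := p) (z := x₂ - x₁) (w := x₁ * x₂)
    (fun x => by rw [sub_mul, mul_sub, x₁_comm, x₂_comm])
    (fun x => by rw [mul_assoc, x₂_comm, ← mul_assoc, x₁_comm, mul_assoc])
    (fun s => exchange_infty_infty (hE.relations s))
    (fun s t hst => hE.coeffSuperCommute _ _ _ _ s t hst) d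
  have h1 := congrArg (coeff₂ (r + 1) (s + 1)) (h.coeff₂_eq i j k l)
  rw [sub_mul, map_sub, mul_assoc] at h1
  simp only [coeff₂_succ_x₁_mul, coeff₂_succ_x₂_mul, coeff₂_mk₂] at h1
  exact h1

lemma dual_exchange (hE : LoopFamily p E) (i j k l : I) (r s : ℕ) :
    (if r = 0 then 0 else
      superBracket p (dualCoeff E d (r - 1)) (dualCoeff E d s) i j k l) -
    (if s = 0 then 0 else
      superBracket p (dualCoeff E d r) (dualCoeff E d (s - 1)) i j k l) =
      exchangeTerm p (dualCoeff E d r) (dualCoeff E d s) i j k l := by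
  have h := exchange_transfer (p := p) (z := x₁ - x₂) (w := 1)
    (fun x => by rw [sub_mul, mul_sub, x₁_comm, x₂_comm])
    (fun x => by rw [mul_one, one_mul])
    (fun s => exchange_zero_zero (hE.relations s))
    (fun s t hst => hE.coeffSuperCommute _ _ _ _ s t hst) d
  have h1 := congrArg (coeff₂ r s) (h.coeff₂_eq i j k l)
  rw [sub_mul, map_sub, one_mul] at h1
  rcases r with _ | r <;> rcases s with _ | s <;>
    simp only [coeff₂_succ_x₁_mul, coeff₂_succ_x₂_mul, coeff₂_zero_x₁_mul, coeff₂_zero_x₂_mul,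
      coeff₂_mk₂, if_true, Nat.add_sub_cancel, if_neg (Nat.succ_ne_zero _)] at h1 ⊢ <;>
    exact h1

lemma mixed_exchange (hE : LoopFamily p E) (i j k l : I) (r s : ℕ) :
    superBracket p (yangCoeff E d (r + 1)) (dualCoeff E d s) i j k l -
    (if s = 0 then 0 else
      superBracket p (yangCoeff E d r) (dualCoeff E d (s - 1)) i j k l) =
      exchangeTerm p (yangCoeff E d r) (dualCoeff E d s) i j k l := by
  have h := exchange_transfer (p := p) (z := 1 - x₁ * x₂) (w := x₁)
    (fun x => by
      rw [sub_mul, mul_sub, mul_assoc, x₂_comm, ← mul_assoc, x₁_comm, mul_assoc, one_mul, mul_one])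
    (fun x => x₁_comm x)
    (fun s => exchange_infty_zero (hE.relations s))
    (fun s t hst => hE.coeffSuperCommute _ _ _ _ s t hst) d
  have h1 := congrArg (coeff₂ (r + 1) s) (h.coeff₂_eq i j k l)
  rw [sub_mul, map_sub, one_mul, mul_assoc] at h1
  rcases s with _ | s <;>
    simp only [coeff₂_succ_x₁_mul, coeff₂_succ_x₂_mul, coeff₂_zero_x₂_mul, coeff₂_mk₂, if_true, Nat.add_sub_cancel, if_neg (Nat.succ_ne_zero _)] at h1 ⊢ <;>
    exact h1

end Coefficients

section Telescope

variable {C : Type*} [AddCommGroup C]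

lemma eq_sum_of_sub_eq {Φ S : ℕ → ℕ → C} (h : ∀ r s, Φ (r + 1) s - Φ r (s + 1) = S r s)
    (h0 : ∀ s, Φ 0 s = 0) (r s : ℕ) :
    Φ (r + 1) s = ∑ a ∈ Finset.range (r + 1), S a (r + s - a) := by
  induction r generalizing s with
  | zero => simp [← h, h0]
  | succ r ih =>
    rw [Finset.sum_range_succ, eq_add_of_sub_eq (h (r + 1) s), ih (s + 1), add_comm]
    congr 1
    · exact Finset.sum_congr rfl fun a _ => by rw [show r + 1 + s = r + (s + 1) by ring]
    · rw [Nat.add_sub_cancel_left]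

lemma eq_sum_range_min {Φ S : ℕ → ℕ → C} (h : ∀ r s, Φ (r + 1) s - Φ r (s + 1) = S r s)
    (h0 : ∀ s, Φ 0 s = 0) (h0' : ∀ r, Φ r 0 = 0) (hS : ∀ r s, S r s = -S s r) (r s : ℕ) :
    Φ (r + 1) (s + 1) =
      ∑ a ∈ Finset.range (min (r + 1) (s + 1)), S a (r + s + 1 - a) := by
  rcases le_total r s with hrs | hrs
  · rw [min_eq_left (by omega), eq_sum_of_sub_eq h h0, add_assoc]
  · rw [min_eq_right (by omega)]
    have := eq_sum_of_sub_eq (Φ := fun s r => Φ r s) (S := S)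
      (fun s r => by rw [hS, ← h, neg_sub]) h0' s (r + 1)
    rw [this]
    exact Finset.sum_congr rfl fun a _ => by rw [show s + (r + 1) = r + s + 1 by ring]

end Telescope

section Relations

variable {C I : Type*} [Ring C] {p : I → ℕ}

lemma exchangeTerm_swap (F G : I → I → C) (i j k l : I) :
    exchangeTerm p F G i j k l = -exchangeTerm p G F i j k l := by
  rw [exchangeTerm, exchangeTerm, ← smul_neg, neg_sub]

variable [DecidableEq I]

lemma superBracket_scalar_left (P : Prop) [Decidable P] (G : I → I → C) (i j k l : I) :
    superBracket p (fun i j => if P ∧ i = j then 1 else 0) G i j k l = 0 := by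
  by_cases hij : i = j
  · have : (-1 : ℤ) ^ ((p i + p j) * (p k + p l)) = 1 := by
      subst hij; exact Even.neg_one_pow (by simp [← two_mul, mul_assoc])
    rw [superBracket, this]
    split_ifs <;> simp
  · simp [superBracket, hij]

lemma superBracket_scalar_right (P : Prop) [Decidable P] (F : I → I → C) (i j k l : I) :
    superBracket p F (fun i j => if P ∧ i = j then 1 else 0) i j k l = 0 := by
  by_cases hkl : k = l
  · have : (-1 : ℤ) ^ ((p i + p j) * (p k + p l)) = 1 := by
      subst hkl
      exact Even.neg_one_pow (by rw [← two_mul, mul_comm, mul_assoc]; exact even_two_mul _)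
    rw [superBracket, this]
    split_ifs <;> simp
  · simp [superBracket, hkl]

variable [Fintype I] {E : ℕ → I → I → ℤ → C} {d : ℕ}

lemma yang_relation (hE : LoopFamily p E) (i j k l : I) (r s : ℕ) :
    superBracket p (yangCoeff E d (r + 1)) (yangCoeff E d (s + 1)) i j k l =
      ∑ a ∈ Finset.range (min (r + 1) (s + 1)),
        exchangeTerm p (yangCoeff E d a) (yangCoeff E d (r + s + 1 - a)) i j k l := by
  have h0 : yangCoeff E d 0 = fun i j => if True ∧ i = j then 1 else 0 := by
    funext i j
    simp [yangCoeff_zero]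
  exact eq_sum_range_min
    (Φ := fun r s => superBracket p (yangCoeff E d r) (yangCoeff E d s) i j k l)
    (S := fun r s => exchangeTerm p (yangCoeff E d r) (yangCoeff E d s) i j k l)
    (fun r s => yang_exchange d hE i j k l r s)
    (fun s => by simp only [h0, superBracket_scalar_left])
    (fun s => by simp only [h0, superBracket_scalar_right])
    (fun r s => exchangeTerm_swap _ _ _ _ _ _) r s

lemma dual_relation_aux (hE : LoopFamily p E) (i j k l : I) (r s : ℕ) :
    superBracket p (dualCoeff E d r) (dualCoeff E d s) i j k l =
      ∑ a ∈ Finset.range (min (r + 1) (s + 1)),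
        exchangeTerm p (dualCoeff E d (r + s + 1 - a)) (dualCoeff E d a) i j k l := by
  have := eq_sum_range_min
    (Φ := fun r s => if r = 0 then 0 else if s = 0 then 0 else
      superBracket p (dualCoeff E d (r - 1)) (dualCoeff E d (s - 1)) i j k l)
    (S := fun r s => exchangeTerm p (dualCoeff E d s) (dualCoeff E d r) i j k l)
    (fun r s => by
      rw [exchangeTerm_swap, ← dual_exchange d hE]
      simp)
    (fun s => by simp) (fun s => by simp)
    (fun r s => exchangeTerm_swap _ _ _ _ _ _) r s
  simpa using this

/-- The images of the generators `t_{ij}^{(-r-1)}`. -/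
def dualGen (E : ℕ → I → I → ℤ → C) (d r : ℕ) (i j : I) : C :=
  (if r = 0 ∧ i = j then 1 else 0) - dualCoeff E d r i j

lemma dual_relation (hE : LoopFamily p E) (i j k l : I) (r s : ℕ) :
    superBracket p (dualGen E d r) (dualGen E d s) i j k l =
      (-1 : ℤ) ^ (p i * p j + p i * p k + p j * p k) •
        ((if k = j then dualGen E d (r + s + 1) i l else 0)
          - (if i = l then dualGen E d (r + s + 1) k j else 0)
          + ∑ a ∈ Finset.range (min (r + 1) (s + 1)),
            (dualGen E d (r + s + 1 - a) k j * dualGen E d a i l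
              - dualGen E d a k j * dualGen E d (r + s + 1 - a) i l)) := by
  have h1 : superBracket p (dualGen E d r) (dualGen E d s) i j k l =
      superBracket p (dualCoeff E d r) (dualCoeff E d s) i j k l := by
    have e1 := superBracket_scalar_left (p := p) (r = 0)
      (fun k l => (if s = 0 ∧ k = l then 1 else 0) - dualCoeff E d s k l) i j k l
    have e2 := superBracket_scalar_right (p := p) (s = 0) (dualCoeff E d r) i j k l
    simp only [superBracket] at e1 e2
    simp only [superBracket, dualGen]
    rw [sub_mul, mul_sub (_ - _), smul_sub, sub_sub_sub_comm, e1, mul_sub, sub_mul, smul_sub,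
      sub_sub_sub_comm, e2]
    abel
  have hy : ∀ r i j, dualCoeff E d r i j = (if r = 0 ∧ i = j then 1 else 0) - dualGen E d r i j :=
    fun r i j => by rw [dualGen, sub_sub_cancel]
  have hy1 : ∀ r, r ≠ 0 → ∀ i j, dualCoeff E d r i j = -dualGen E d r i j := by
    intro r hr i j
    simp [hy, hr]
  have hterm : ∀ a ∈ Finset.range (min r s),
      exchangeTerm p (dualCoeff E d (r + s + 1 - (a + 1))) (dualCoeff E d (a + 1)) i j k l =
      (-1 : ℤ) ^ (p i * p j + p i * p k + p j * p k) •
        (dualGen E d (r + s + 1 - (a + 1)) k j * dualGen E d (a + 1) i l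
          - dualGen E d (a + 1) k j * dualGen E d (r + s + 1 - (a + 1)) i l) := by
    intro a ha
    have ha := Finset.mem_range.mp ha
    have hne : r + s + 1 - (a + 1) ≠ 0 := by omega
    simp only [exchangeTerm, hy1 _ hne, hy1 _ (Nat.succ_ne_zero a), neg_mul_neg]
  have hlast : exchangeTerm p (dualCoeff E d (r + s + 1)) (dualCoeff E d 0) i j k l =
      (-1 : ℤ) ^ (p i * p j + p i * p k + p j * p k) •
        ((if k = j then dualGen E d (r + s + 1) i l else 0)
          - (if i = l then dualGen E d (r + s + 1) k j else 0)
          + (dualGen E d (r + s + 1) k j * dualGen E d 0 i l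
            - dualGen E d 0 k j * dualGen E d (r + s + 1) i l)) := by
    simp only [exchangeTerm, hy1 _ (Nat.succ_ne_zero (r + s)), hy 0, true_and]
    congr 1
    split_ifs <;> noncomm_ring
  rw [h1, dual_relation_aux hE, Nat.add_min_add_right, Finset.sum_range_succ',
    Finset.sum_range_succ', Finset.sum_congr rfl hterm, Nat.sub_zero, hlast, ← Finset.smul_sum,
    ← smul_add]
  exact congrArg _ (add_left_comm _ _ _)

end Relations

section Representation

variable {C : Type*} [Ring C] [Algebra ℂ C] {m n : ℕ}

/-- The images of the generators in the algebra generated by a family of loop algebras. -/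
def genImage (E : ℕ → Fin (m + n) → Fin (m + n) → ℤ → C) (d : ℕ) : GD m n → C
  | Sum.inl (i, j, r) => yangCoeff E d (r + 1) i j
  | Sum.inr (i, j, r) => dualGen E d r i j

variable {E : ℕ → Fin (m + n) → Fin (m + n) → ℤ → C} {d : ℕ}

lemma lift_tc (i j : Fin (m + n)) (r : ℕ) :
    FreeAlgebra.lift ℂ (genImage E d) (tc m n i j r) = yangCoeff E d r i j := by
  rcases r with _ | r
  · rw [yangCoeff_zero, tc]
    split_ifs <;> simp
  · rw [tc, FreeAlgebra.lift_ι_apply, genImage]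

lemma lift_tdc (i j : Fin (m + n)) (r : ℕ) :
    FreeAlgebra.lift ℂ (genImage E d) (tdc m n i j r) = dualCoeff E d r i j := by
  rw [tdc, map_sub, FreeAlgebra.lift_ι_apply, genImage, dualGen]
  split_ifs <;> simp

lemma lift_tdD (i j : Fin (m + n)) (r : ℕ) :
    FreeAlgebra.lift ℂ (genImage E d) (tdD m n i j (r + 1)) = dualGen E d r i j := by
  rw [tdD, FreeAlgebra.lift_ι_apply, genImage, Nat.add_sub_cancel]

lemma lift_Xmix (i j k l : Fin (m + n)) (r s : ℕ) :
    FreeAlgebra.lift ℂ (genImage E d) (Xmix m n i j k l r s) =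
      (-1 : ℤ) ^ (par m i * par m j + par m j + par m k * par m l + par m l
        + (par m i + par m j) * (par m k + par m l)) •
        superBracket (par m) (yangCoeff E d r) (dualCoeff E d s) i j k l := by
  simp only [Xmix, map_sub, map_mul, lift_tc, lift_tdc, superBracket,
    neg_one_pow_mul_eq_zsmul, smul_sub, smul_smul, ← pow_add, map_zsmul]
  congr 2
  apply sign_congr
  push_cast
  generalize (par m i : ZMod 2) = x1
  generalize (par m j : ZMod 2) = x2
  generalize (par m k : ZMod 2) = x3
  generalize (par m l : ZMod 2) = x4
  revert x1 x2 x3 x4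
  decide

lemma lift_eq_of_rel (hE : LoopFamily (par m) E) ⦃x y : FD m n⦄ (h : DRel m n x y) :
    FreeAlgebra.lift ℂ (genImage E d) x = FreeAlgebra.lift ℂ (genImage E d) y := by
  cases h with
  | yang i j k l r s =>
    have := yang_relation (d := d) hE i j k l r s
    simp only [superBracket, exchangeTerm, ← Finset.smul_sum] at this
    simpa only [map_sub, map_mul, map_sum, lift_tc,
      neg_one_pow_mul_eq_zsmul, map_zsmul] using this
  | dual i j k l r s =>
    have := dual_relation (d := d) hE i j k l r s
    have hidx : ∀ a ∈ Finset.range (min (r + 1) (s + 1)), r + s + 2 - a = r + s + 1 - a + 1 := by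
      intro a ha
      have := Finset.mem_range.mp ha
      omega
    rw [Finset.sum_congr rfl fun a ha => by rw [hidx a ha]]
    simp only [superBracket] at this
    simpa only [map_sub, map_add, map_mul, map_sum, lift_tdD,
      neg_one_pow_mul_eq_zsmul, map_zsmul, apply_ite (FreeAlgebra.lift ℂ (genImage E d)), map_zero] using this
  | mixed i j k l r s =>
    have := mixed_exchange d hE i j k l r s
    simp only [map_sub, map_mul, lift_tc, lift_tdc, lift_Xmix,
      neg_one_pow_mul_eq_zsmul, map_zsmul, apply_ite (FreeAlgebra.lift ℂ (genImage E d)), map_zero]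
    have hs : ∀ e : ℤ, (if s = 0 then 0 else
        e • superBracket (par m) (yangCoeff E d r) (dualCoeff E d (s - 1)) i j k l) =
        e • (if s = 0 then 0 else
          superBracket (par m) (yangCoeff E d r) (dualCoeff E d (s - 1)) i j k l) := by
      intro e
      split_ifs <;> simp
    rw [hs, ← smul_sub, this, exchangeTerm, smul_smul, ← pow_add]
    congr 1
    apply sign_congr
    push_cast
    generalize (par m i : ZMod 2) = x1
    generalize (par m j : ZMod 2) = x2
    generalize (par m k : ZMod 2) = x3
    generalize (par m l : ZMod 2) = x4
    revert x1 x2 x3 x4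
    decide

/-- The homomorphism from the double Yangian given by the transfer matrices with `d` factors. -/
def transferHom (hE : LoopFamily (par m) E) (d : ℕ) : DY m n →ₐ[ℂ] C :=
  RingQuot.liftAlgHom ℂ ⟨FreeAlgebra.lift ℂ (genImage E d), lift_eq_of_rel hE⟩

lemma transferHom_genD (hE : LoopFamily (par m) E) (g : GD m n) :
    transferHom hE d (genD m n g) = genImage E d g := by
  rw [transferHom, genD, RingQuot.liftAlgHom_mkAlgHom_apply, FreeAlgebra.lift_ι_apply]

end Representation

section Model

variable {I : Type*} [DecidableEq I]

/-- A slot is either vacant or occupied by a loop matrix unit. -/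
abbrev Slot (I : Type*) := Option (I × I × ℤ)

/-- The parity of the content of a slot. -/
def slotParity (p : I → ℕ) : Slot I → ℕ
  | none => 0
  | some (i, l, _) => p i + p l

/-- The action of the loop matrix unit `e_{ij} a^r` on the functions on one slot, characterised
by creating `(i, j, r)` from the vacancy and multiplying matrix units. -/
def slotAct (p : I → ℕ) (i j : I) (r : ℤ) (φ : Slot I → ℂ) : Slot I → ℂ
  | none => 0
  | some (i', l, q) =>
    if i' = i then
      (if l = j ∧ q = r then φ none else 0) + (-1 : ℤ) ^ p j • φ (some (j, l, q - r))
    else 0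

variable {p : I → ℕ}

lemma slotAct_slotAct (i j k l : I) (r q : ℤ) (φ : Slot I → ℂ) (x : Slot I) :
    slotAct p i j r (slotAct p k l q φ) x =
      if j = k then (-1 : ℤ) ^ p j • slotAct p i l (r + q) φ x else 0 := by
  rcases x with _ | ⟨i', l', q'⟩
  · simp [slotAct]
  · have h : q' - r = q ↔ q' = r + q := by omega
    simp only [slotAct, h, sub_sub]
    split_ifs <;> simp_all

lemma slotAct_comm (i j k l : I) (r q : ℤ) (F : Slot I → Slot I → ℂ) (x y : Slot I) :
    slotAct p i j r (fun x => slotAct p k l q (F x) y) x =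
      slotAct p k l q (fun y => slotAct p i j r (fun x => F x y) x) y := by
  rcases x with _ | ⟨i', l', q'⟩ <;> rcases y with _ | ⟨i'', l'', q''⟩
  · simp [slotAct]
  · simp [slotAct]
  · simp [slotAct]
  · simp only [slotAct]
    split_ifs <;> simp <;> ring

lemma slotAct_sign (b c : ℕ) (i j : I) (r : ℤ) (φ : Slot I → ℂ) (x : Slot I) :
    slotAct p i j r (fun y => (-1 : ℤ) ^ (b * (c + slotParity p y)) • φ y) x =
      (-1 : ℤ) ^ ((p i + p j) * b + b * (c + slotParity p x)) • slotAct p i j r φ x := by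
  rcases x with _ | ⟨i', l, q⟩
  · simp [slotAct]
  · simp only [slotAct, slotParity]
    by_cases hi : i' = i
    · subst hi
      have h2 : (-1 : ℤ) ^ ((p i' + p j) * b + b * (c + (p i' + p l))) =
          (-1) ^ (b * (c + (p j + p l))) := by
        apply sign_congr
        push_cast
        generalize (p i' : ZMod 2) = x1
        generalize (p j : ZMod 2) = x2
        generalize (p l : ZMod 2) = x3
        generalize (b : ZMod 2) = x4
        generalize (c : ZMod 2) = x5
        revert x1 x2 x3 x4 x5
        decide
      rw [if_pos rfl, if_pos rfl, h2, smul_add, smul_comm]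
      congr 1
      split_ifs with h
      · obtain ⟨rfl, -⟩ := h
        congr 1
        apply sign_congr
        push_cast
        generalize (p l : ZMod 2) = x3
        generalize (b : ZMod 2) = x4
        generalize (c : ZMod 2) = x5
        revert x3 x4 x5
        decide
      · simp
    · simp [hi]

lemma slotAct_smul (i j : I) (r : ℤ) {R : Type*} [Monoid R] [DistribMulAction R ℂ]
    [SMulCommClass ℤ R ℂ] (a : R) (φ : Slot I → ℂ) (x : Slot I) :
    slotAct p i j r (fun y => a • φ y) x = a • slotAct p i j r φ x := by
  rcases x with _ | ⟨i', l, q⟩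
  · simp [slotAct]
  · simp only [slotAct]
    split_ifs <;> simp [smul_add, smul_comm]

lemma slotAct_add (i j : I) (r : ℤ) (φ ψ : Slot I → ℂ) (x : Slot I) :
    slotAct p i j r (fun y => φ y + ψ y) x = slotAct p i j r φ x + slotAct p i j r ψ x := by
  rcases x with _ | ⟨i', l, q⟩
  · simp [slotAct]
  · simp only [slotAct]
    split_ifs
    · rw [smul_add]; abel
    · rw [smul_add]; abel
    · simp

/-- The total parity of the slots before `s`. -/
def parityBefore (p : I → ℕ) (s : ℕ) (σ : ℕ → Slot I) : ℕ :=
  ∑ t ∈ Finset.range s, slotParity p (σ t)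

lemma parityBefore_update_of_le {s t : ℕ} (h : s ≤ t) (σ : ℕ → Slot I) (x : Slot I) :
    parityBefore p s (Function.update σ t x) = parityBefore p s σ :=
  Finset.sum_congr rfl fun u hu => by
    rw [Function.update_of_ne ((Finset.mem_range.mp hu).trans_le h).ne]

lemma exists_parityBefore_update {s t : ℕ} (h : s < t) (σ : ℕ → Slot I) :
    ∃ c, ∀ x, parityBefore p t (Function.update σ s x) = c + slotParity p x := by
  refine ⟨∑ u ∈ (Finset.range t).erase s, slotParity p (σ u), fun x => ?_⟩
  rw [parityBefore, ← Finset.sum_erase_add _ _ (Finset.mem_range.mpr h), Function.update_self]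
  congr 1
  exact Finset.sum_congr rfl fun u hu => by
    rw [Function.update_of_ne (Finset.ne_of_mem_erase hu)]

/-- The loop matrix unit `e_{ij} a^r` acting on the slot `s`, with the Koszul sign. -/
def slotOp (p : I → ℕ) (s : ℕ) (i j : I) (r : ℤ) : Module.End ℂ ((ℕ → Slot I) → ℂ) where
  toFun f σ := (-1 : ℤ) ^ ((p i + p j) * parityBefore p s σ) •
    slotAct p i j r (fun x => f (Function.update σ s x)) (σ s)
  map_add' f g := by
    funext σ
    simp only [Pi.add_apply]
    rw [slotAct_add, smul_add]
  map_smul' a f := by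
    funext σ
    simp only [Pi.smul_apply, RingHom.id_apply]
    rw [slotAct_smul, smul_comm]

lemma slotOp_apply (s : ℕ) (i j : I) (r : ℤ) (f : (ℕ → Slot I) → ℂ) (σ : ℕ → Slot I) :
    slotOp p s i j r f σ = (-1 : ℤ) ^ ((p i + p j) * parityBefore p s σ) •
      slotAct p i j r (fun x => f (Function.update σ s x)) (σ s) := rfl

lemma slotOp_superCommute {s t : ℕ} (h : s < t) (i j k l : I) (r q : ℤ) :
    slotOp p s i j r * slotOp p t k l q =
      (-1 : ℤ) ^ ((p i + p j) * (p k + p l)) • (slotOp p t k l q * slotOp p s i j r) := by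
  refine LinearMap.ext fun f => funext fun σ => ?_
  obtain ⟨c, hc⟩ := exists_parityBefore_update (p := p) h σ
  have hc' := hc (σ s)
  rw [Function.update_eq_self] at hc'
  simp only [LinearMap.smul_apply, Module.End.mul_apply, Pi.smul_apply, slotOp_apply, hc,
    Function.update_of_ne h.ne', Function.update_of_ne h.ne, parityBefore_update_of_le h.le]
  rw [slotAct_sign, slotAct_comm, slotAct_smul, hc']
  simp only [smul_smul, Function.update_comm h.ne, ← pow_add]
  congr 1
  congr 1
  ring

lemma loopFamily_slotOp (p : I → ℕ) : LoopFamily p (slotOp p) where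
  relations s i j k l r q := by
    refine LinearMap.ext fun f => funext fun σ => ?_
    simp only [Module.End.mul_apply, slotOp_apply, parityBefore_update_of_le le_rfl,
      Function.update_self, Function.update_idem]
    rw [slotAct_smul, slotAct_slotAct]
    split_ifs with hjk
    · subst hjk
      simp only [LinearMap.smul_apply, Pi.smul_apply, slotOp_apply, smul_smul, ← pow_add]
      congr 1
      apply sign_congr
      push_cast
      generalize (p i : ZMod 2) = x1
      generalize (p j : ZMod 2) = x2
      generalize (p l : ZMod 2) = x3
      generalize (parityBefore p s σ : ZMod 2) = x4
      revert x1 x2 x3 x4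
      decide
    · simp
  superCommute s t hst i j k l r q := by
    rcases hst.lt_or_gt with h | h
    · exact slotOp_superCommute h i j k l r q
    · rw [slotOp_superCommute h, smul_smul, mul_comm (p k + p l), ← pow_add, ← two_mul]
      simp

end Model

section Filtration

variable {I : Type*}

/-- The exponent of the content of a slot. -/
def slotDegree : Slot I → ℤ
  | none => 0
  | some (_, _, q) => q

/-- The total exponent of the first `d` slots. -/
def stateDegree (d : ℕ) (σ : ℕ → Slot I) : ℤ := ∑ t ∈ Finset.range d, slotDegree (σ t)

lemma stateDegree_update {d s : ℕ} (h : s < d) (σ : ℕ → Slot I) (x : Slot I) :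
    stateDegree d (Function.update σ s x) + slotDegree (σ s) = stateDegree d σ + slotDegree x := by
  have hs := Finset.mem_range.mpr h
  rw [stateDegree, stateDegree, ← Finset.sum_erase_add _ _ hs,
    ← Finset.sum_erase_add (Finset.range d) (fun t => slotDegree (σ t)) hs, Function.update_self,
    Finset.sum_congr rfl fun u hu => by rw [Function.update_of_ne (Finset.ne_of_mem_erase hu)]]
  abel

/-- The functions supported on the states of degree at most `B`. -/
def degreeLE (d : ℕ) (B : ℤ) : Submodule ℂ ((ℕ → Slot I) → ℂ) where
  carrier := {f | ∀ σ, B < stateDegree d σ → f σ = 0}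
  add_mem' hf hg σ hσ := by simp [hf σ hσ, hg σ hσ]
  zero_mem' σ _ := rfl
  smul_mem' a f hf σ hσ := by simp [hf σ hσ]

lemma degreeLE_mono (d : ℕ) {B B' : ℤ} (h : B ≤ B') :
    (degreeLE d B : Submodule ℂ ((ℕ → Slot I) → ℂ)) ≤ degreeLE d B' :=
  fun _ hf σ hσ => hf σ (h.trans_lt hσ)

/-- The operators raising the degree by at most `D`. -/
def raisesBy (d : ℕ) (D : ℤ) : AddSubgroup (Module.End ℂ ((ℕ → Slot I) → ℂ)) where
  carrier := {A | ∀ B, ∀ f ∈ degreeLE d B, A f ∈ degreeLE d (D + B)}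
  add_mem' hA hA' B f hf := add_mem (hA B f hf) (hA' B f hf)
  zero_mem' _ _ _ := zero_mem _
  neg_mem' hA B f hf := neg_mem (hA B f hf)

lemma raisesBy_mul {d : ℕ} {D D' : ℤ} {A A' : Module.End ℂ ((ℕ → Slot I) → ℂ)}
    (hA : A ∈ raisesBy d D) (hA' : A' ∈ raisesBy d D') : A * A' ∈ raisesBy d (D + D') := by
  intro B f hf
  rw [add_assoc]
  exact hA _ _ (hA' B f hf)

lemma raisesBy_mono {d : ℕ} {D D' : ℤ} (h : D ≤ D') :
    (raisesBy d D : AddSubgroup (Module.End ℂ ((ℕ → Slot I) → ℂ))) ≤ raisesBy d D' :=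
  fun _ hA B f hf => degreeLE_mono d (by omega) (hA B f hf)

lemma one_mem_raisesBy (d : ℕ) :
    (1 : Module.End ℂ ((ℕ → Slot I) → ℂ)) ∈ raisesBy d 0 := by
  intro _ _ hf
  rwa [zero_add]

lemma slotOp_mem_raisesBy [DecidableEq I] {p : I → ℕ} {d s : ℕ} (h : s < d) (i j : I) (r : ℤ) :
    slotOp p s i j r ∈ raisesBy d r := by
  intro B f hf σ hσ
  rw [slotOp_apply, smul_eq_zero]
  right
  rcases hx : σ s with _ | ⟨i', l, q⟩
  · rfl
  · simp only [slotAct]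
    have h1 := stateDegree_update h σ none
    have h2 := stateDegree_update h σ (some (j, l, q - r))
    simp only [hx, slotDegree] at h1 h2
    rw [hf _ (by omega : B < stateDegree d (Function.update σ s (some (j, l, q - r))))]
    split_ifs with hi hl
    · rw [hf _ (by omega)]
      simp
    · simp
    · rfl

variable [Fintype I] [DecidableEq I]

lemma coeff_transfer_sub_mem {e : ℕ → I → I → (Module.End ℂ ((ℕ → Slot I) → ℂ))⟦X⟧} {D : ℕ → ℤ}
    {d : ℕ} (hD : ∀ a b, D a + D b = D (a + b) - 1) (c : ℕ)
    (he : ∀ s < c, ∀ i j a, coeff a (e s i j) ∈ raisesBy d (D a)) (i j : I) (a : ℕ) :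
    coeff a (transfer e c i j) - ((if a = 0 ∧ i = j then 1 else 0) +
      ∑ s ∈ Finset.range c, coeff a (e s i j)) ∈ raisesBy d (D a - 1) := by
  induction c generalizing i j a with
  | zero =>
    have : coeff a (transfer e 0 i j) = if a = 0 ∧ i = j then 1 else 0 := by
      simp only [transfer]
      split_ifs <;> simp_all [coeff_one]
    rw [this]
    simp [zero_mem]
  | succ c ih =>
    replace ih := ih fun s hs => he s (hs.trans c.lt_succ_self)
    have hstep : coeff a (transfer e (c + 1) i j) =
        coeff a (transfer e c i j) + coeff a (e c i j) +
          ∑ k, ∑ x ∈ Finset.HasAntidiagonal.antidiagonal a,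
            (coeff x.1 (transfer e c i k) - if x.1 = 0 ∧ i = k then 1 else 0) *
              coeff x.2 (e c k j) := by
      have h1 : ∑ k, transfer e c i k * (if k = j then 1 else 0) = transfer e c i j := by simp
      have h2 : ∀ k, coeff a (transfer e c i k * e c k j) =
          (if i = k then coeff a (e c k j) else 0) + ∑ x ∈ Finset.HasAntidiagonal.antidiagonal a,
            (coeff x.1 (transfer e c i k) - if x.1 = 0 ∧ i = k then 1 else 0) *
              coeff x.2 (e c k j) := by
        intro k
        have h3 : ∀ x : ℕ, coeff x (if i = k then (1 : (Module.End ℂ ((ℕ → Slot I) → ℂ))⟦X⟧) else 0)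
            = if x = 0 ∧ i = k then 1 else 0 := by
          intro x
          by_cases h : i = k <;> simp [h, coeff_one]
        have h4 : transfer e c i k * e c k j = (if i = k then 1 else 0) * e c k j +
            (transfer e c i k - if i = k then 1 else 0) * e c k j := by
          rw [sub_mul, add_sub_cancel]
        rw [h4, map_add, coeff_mul a (_ - _)]
        simp only [map_sub, h3]
        congr 1
        split_ifs <;> simp
      simp only [transfer, onePlus, mul_add, Finset.sum_add_distrib, h1, map_add, map_sum, h2]
      simp [add_assoc]
    rw [hstep, Finset.sum_range_succ, ← add_assoc, add_right_comm, add_sub_add_right_eq_sub,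
      add_sub_right_comm]
    refine add_mem (ih i j a) (sum_mem fun k _ => sum_mem fun x hx => ?_)
    have hxa := Finset.HasAntidiagonal.mem_antidiagonal.mp hx
    rw [← hxa, ← hD]
    refine raisesBy_mul ?_ (he c c.lt_succ_self k j x.2)
    have h5 := ih i k x.1
    rw [← sub_sub] at h5
    have h6 := add_mem (raisesBy_mono (by omega) h5)
      (sum_mem fun s hs => he s ((Finset.mem_range.mp hs).trans c.lt_succ_self) i k x.1)
    rwa [sub_add_cancel] at h6

/-- The sum of a loop matrix unit over the first `d` slots. -/
def leading (p : I → ℕ) (d : ℕ) (x : I × I × ℤ) : Module.End ℂ ((ℕ → Slot I) → ℂ) :=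
  ∑ s ∈ Finset.range d, slotOp p s x.1 x.2.1 x.2.2

lemma leading_mem_raisesBy (p : I → ℕ) (d : ℕ) (x : I × I × ℤ) :
    leading p d x ∈ raisesBy d x.2.2 :=
  sum_mem fun _ hs => slotOp_mem_raisesBy (Finset.mem_range.mp hs) _ _ _

lemma yangCoeff_sub_leading_mem (p : I → ℕ) (d r : ℕ) (i j : I) :
    yangCoeff (slotOp p) d (r + 1) i j - leading p d (i, j, r) ∈ raisesBy d (r - 1) := by
  have := coeff_transfer_sub_mem (e := fun s => seriesAtInfty (slotOp p s)) (D := fun a => a - 1)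
    (d := d) (fun a b => by push_cast; ring) d (fun s hs i j a => by
      rw [coeff_seriesAtInfty]
      split_ifs
      · exact zero_mem _
      · exact slotOp_mem_raisesBy hs i j _) i j (r + 1)
  simpa [coeff_seriesAtInfty, leading, yangCoeff] using this

lemma dualGen_sub_leading_mem (p : I → ℕ) (d r : ℕ) (i j : I) :
    dualGen (slotOp p) d r i j - leading p d (i, j, -((r : ℤ) + 1)) ∈
      raisesBy d (-((r : ℤ) + 1) - 1) := by
  have := coeff_transfer_sub_mem (e := fun s => seriesAtZero (slotOp p s)) (D := fun a => -a - 1)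
    (d := d) (fun a b => by push_cast; ring) d (fun s hs i j a => by
      rw [coeff_seriesAtZero]
      exact neg_mem (slotOp_mem_raisesBy hs i j _)) i j r
  rw [← neg_mem_iff] at this
  simp only [coeff_seriesAtZero, Finset.sum_neg_distrib] at this
  rw [dualGen, leading, dualCoeff, neg_add']
  convert this using 1
  abel

end Filtration

section LeadingTerm

variable {I : Type*}

/-- The vacuum: the indicator function of the state whose slots are all vacant. -/
def vacuum (I : Type*) : (ℕ → Slot I) → ℂ :=
  open Classical in fun σ => if σ = fun _ => none then 1 else 0

/-- The multiset of the contents of the first `d` slots. -/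
def contents (d : ℕ) (σ : ℕ → Slot I) : Multiset (I × I × ℤ) :=
  ∑ t ∈ Finset.range d, (σ t).toFinset.val

lemma contents_update {d s : ℕ} (h : s < d) (σ : ℕ → Slot I) (x : Slot I) :
    contents d (Function.update σ s x) + (σ s).toFinset.val = contents d σ + x.toFinset.val := by
  have hs := Finset.mem_range.mpr h
  rw [contents, contents, ← Finset.sum_erase_add _ _ hs,
    ← Finset.sum_erase_add (Finset.range d) (fun t => (σ t).toFinset.val) hs, Function.update_self,
    Finset.sum_congr rfl fun u hu => by rw [Function.update_of_ne (Finset.ne_of_mem_erase hu)]]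
  abel

lemma mem_contents {d t : ℕ} (h : t < d) {σ : ℕ → Slot I} {x : I × I × ℤ} (hx : σ t = some x) :
    x ∈ contents d σ :=
  Multiset.mem_sum.mpr ⟨t, Finset.mem_range.mpr h, by simp [hx]⟩

variable [DecidableEq I] {p : I → ℕ} {d : ℕ}

/-- The vector obtained by applying leading parts to the vacuum. -/
def leadingVector (p : I → ℕ) (d : ℕ) (w : List (I × I × ℤ)) : (ℕ → Slot I) → ℂ :=
  (w.map (leading p d)).prod (vacuum I)

lemma leadingVector_cons (x : I × I × ℤ) (w : List (I × I × ℤ)) (σ : ℕ → Slot I) :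
    leadingVector p d (x :: w) σ = ∑ s ∈ Finset.range d,
      slotOp p s x.1 x.2.1 x.2.2 (leadingVector p d w) σ := by
  simp [leadingVector, leading, Module.End.mul_apply, LinearMap.sum_apply, Finset.sum_apply]

lemma leadingVector_contents (w : List (I × I × ℤ)) (σ : ℕ → Slot I)
    (h : leadingVector p d w σ ≠ 0) :
    (contents d σ).card ≤ w.length ∧ ((contents d σ).card = w.length → contents d σ = w) := by
  induction w generalizing σ with
  | nil =>
    have hσ : σ = fun _ => none := by
      by_contra hσ
      exact h (by simp [leadingVector, vacuum, hσ])
    have : contents d σ = 0 := by simp [contents, hσ]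
    simp [this]
  | cons x w ih =>
    rw [leadingVector_cons] at h
    obtain ⟨s, hs, hne⟩ := Finset.exists_ne_zero_of_sum_ne_zero h
    have hs := Finset.mem_range.mp hs
    rw [slotOp_apply] at hne
    replace hne := right_ne_zero_of_smul hne
    obtain ⟨i, j, r⟩ := x
    rcases hx : σ s with _ | ⟨i', l, q⟩
    · simp [hx, slotAct] at hne
    · simp only [hx, slotAct] at hne
      have h1 := contents_update hs σ none
      have h2 := contents_update hs σ (some (j, l, q - r))
      simp only [hx, Option.toFinset_some, Option.toFinset_none, Finset.singleton_val,
        Finset.empty_val, add_zero] at h1 h2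
      by_cases hf : leadingVector p d w (Function.update σ s (some (j, l, q - r))) = 0
      · have hil : i' = i ∧ (l = j ∧ q = r) := by
          by_contra hcon
          apply hne
          rw [hf]
          split_ifs <;> simp_all
        obtain ⟨rfl, rfl, rfl⟩ := hil
        rw [if_pos rfl, if_pos ⟨rfl, rfl⟩, hf, smul_zero, add_zero] at hne
        obtain ⟨h3, h4⟩ := ih _ hne
        have h5 := congrArg Multiset.card h1
        rw [Multiset.card_add, Multiset.card_singleton] at h5
        refine ⟨by simp only [List.length_cons]; omega, fun h6 => ?_⟩
        rw [← h1, h4 (by simp only [List.length_cons] at h6; omega), add_comm,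
          Multiset.singleton_add, Multiset.cons_coe]
      · obtain ⟨h3, -⟩ := ih _ hf
        have h5 := congrArg Multiset.card h2
        rw [Multiset.card_add, Multiset.card_add, Multiset.card_singleton,
          Multiset.card_singleton] at h5
        simp only [List.length_cons]
        omega

/-- The state whose slots contain the letters of `w`, the first `k` ones being vacant. -/
def wordState (w : List (I × I × ℤ)) (k : ℕ) (t : ℕ) : Slot I := if t < k then none else w[t]?

lemma wordState_append_nil (u : List (I × I × ℤ)) : wordState u u.length = fun _ => none := by
  funext t
  simp [wordState]

lemma update_wordState (w : List (I × I × ℤ)) (k : ℕ) :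
    Function.update (wordState w k) k none = wordState w (k + 1) := by
  funext t
  rcases eq_or_ne t k with rfl | h
  · simp [wordState]
  · rw [Function.update_of_ne h, wordState, wordState]
    congr 1
    exact propext ⟨fun h' => h'.trans k.lt_succ_self, fun h' => (Nat.lt_succ_iff.mp h').lt_of_ne h⟩

lemma contents_wordState (u v : List (I × I × ℤ)) :
    contents (u ++ v).length (wordState (u ++ v) u.length) = v := by
  induction v generalizing u with
  | nil =>
    rw [List.append_nil, wordState_append_nil]
    simp [contents]
  | cons x v ih =>
    have h1 := contents_update (d := (u ++ x :: v).length) (s := u.length) (by simp)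
      (wordState (u ++ x :: v) u.length) none
    have h2 := ih (u ++ [x])
    rw [List.append_assoc, List.singleton_append,
      show (u ++ [x]).length = u.length + 1 by simp] at h2
    rw [update_wordState, h2] at h1
    rw [← Multiset.cons_coe, ← Multiset.singleton_add, add_comm]
    simpa [wordState] using h1.symm

lemma slotOp_leadingVector {u v : List (I × I × ℤ)} {x : I × I × ℤ}
    (hw : ∀ y ∈ u ++ x :: v, Odd (p y.1 + p y.2.1) → (u ++ x :: v).count y ≤ 1)
    {σ : ℕ → Slot I} (hσ : ∀ t, σ t = none ∨ σ t = (u ++ x :: v)[t]?)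
    (hcard : (contents d σ).card = v.length + 1) {s : ℕ} (hs : s < d) :
    slotOp p s x.1 x.2.1 x.2.2 (leadingVector p d v) σ =
      if σ s = some x then leadingVector p d v (Function.update σ s none) else 0 := by
  obtain ⟨i, j, r⟩ := x
  rw [slotOp_apply]
  rcases hx : σ s with _ | ⟨i', l, q⟩
  · simp [slotAct]
  have h1 := contents_update hs σ none
  have h2 := congrArg Multiset.card (contents_update hs σ (some (j, l, q - r)))
  simp only [hx, Option.toFinset_some, Option.toFinset_none, Finset.singleton_val,
    Finset.empty_val, add_zero, Multiset.card_add, Multiset.card_singleton] at h1 h2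
  have hf : leadingVector p d v (Function.update σ s (some (j, l, q - r))) = 0 := by
    by_contra hf
    have := (leadingVector_contents _ _ hf).1
    omega
  simp only [slotAct, hf, smul_zero, add_zero, Option.some.injEq, Prod.mk.injEq]
  by_cases hxy : i' = i ∧ l = j ∧ q = r
  · obtain ⟨rfl, rfl, rfl⟩ := hxy
    simp only [and_self, if_true]
    by_cases hf' : leadingVector p d v (Function.update σ s none) = 0
    · rw [hf', smul_zero]
    have h3 : contents d (Function.update σ s none) = v := by
      refine (leadingVector_contents _ _ hf').2 ?_
      have := congrArg Multiset.card h1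
      rw [Multiset.card_add, Multiset.card_singleton] at this
      omega
    have heven : Even ((p i' + p l) * parityBefore p s σ) := by
      rcases Nat.even_or_odd (p i' + p l) with he | ho
      · exact he.mul_right _
      refine Even.mul_left (Finset.even_sum _ fun t ht => ?_) _
      have ht := Finset.mem_range.mp ht
      have hcount := hw (i', l, q) (by simp) ho
      have hsu : s ≤ u.length := by
        by_contra hsu
        have h4 := (hσ s).resolve_left (by simp [hx])
        rw [hx, List.getElem?_append_right (by omega),
          show s - u.length = (s - u.length - 1) + 1 by omega, List.getElem?_cons_succ] at h4
        have h5 := List.count_pos_iff.mpr (List.mem_of_getElem? h4.symm)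
        rw [List.count_append, List.count_cons_self] at hcount
        omega
      rcases hy : σ t with _ | y
      · exact Even.zero
      have h4 := (hσ t).resolve_left (by simp [hy])
      rw [hy, List.getElem?_append_left (by omega)] at h4
      have hyu := List.mem_of_getElem? h4.symm
      have hyv : y ∈ v := by
        rw [← Multiset.mem_coe, ← h3]
        exact mem_contents (ht.trans hs) (by rw [Function.update_of_ne ht.ne, hy])
      rw [← Nat.not_odd_iff_even]
      intro hodd
      have h5 := hw y (by simp [hyu]) hodd
      have h6 := List.count_pos_iff.mpr hyu
      have h7 := List.count_pos_iff.mpr hyv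
      rw [List.count_append] at h5
      have h8 := List.count_le_count_cons (a := y) (b := (i', l, q)) (l := v)
      omega
    rw [heven.neg_one_pow, one_smul]
  · rw [if_neg hxy]
    split_ifs with h3 h4
    · exact absurd ⟨h3, h4⟩ hxy
    · exact smul_zero _
    · exact smul_zero _

open ComplexOrder in
lemma leadingVector_nonneg_and_pos (u v : List (I × I × ℤ))
    (hw : ∀ y ∈ u ++ v, Odd (p y.1 + p y.2.1) → (u ++ v).count y ≤ 1)
    (hd : d = (u ++ v).length) :
    (∀ σ : ℕ → Slot I, (∀ t, σ t = none ∨ σ t = (u ++ v)[t]?) →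
      (contents d σ).card = v.length → 0 ≤ leadingVector p d v σ) ∧
    0 < leadingVector p d v (wordState (u ++ v) u.length) := by
  induction v generalizing u with
  | nil =>
    constructor
    · intro σ _ _
      simp only [leadingVector, vacuum, List.map_nil, List.prod_nil, Module.End.one_apply]
      split_ifs <;> simp
    · rw [List.append_nil, wordState_append_nil]
      simp [leadingVector, vacuum]
  | cons x v ih =>
    have happ : u ++ [x] ++ v = u ++ x :: v := by simp
    obtain ⟨ih1, ih2⟩ := ih (u ++ [x]) (by rwa [happ]) (by rwa [happ])
    rw [happ] at ih1 ih2
    have hu : u.length < d := by simp [hd]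
    have hnonneg : ∀ σ : ℕ → Slot I, (∀ t, σ t = none ∨ σ t = (u ++ x :: v)[t]?) →
        (contents d σ).card = v.length + 1 → ∀ s ∈ Finset.range d,
        0 ≤ slotOp p s x.1 x.2.1 x.2.2 (leadingVector p d v) σ := by
      intro σ hσ hcard s hs
      have hs := Finset.mem_range.mp hs
      rw [slotOp_leadingVector hw hσ hcard hs]
      split_ifs with hx
      · refine ih1 _ (fun t => ?_) ?_
        · rcases eq_or_ne t s with rfl | hts
          · simp
          · rw [Function.update_of_ne hts]
            exact hσ t
        · have := congrArg Multiset.card (contents_update hs σ none)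
          simp only [hx, Option.toFinset_some, Option.toFinset_none, Finset.singleton_val,
            Finset.empty_val, add_zero, Multiset.card_add, Multiset.card_singleton] at this
          omega
      · exact le_rfl
    constructor
    · intro σ hσ hcard
      rw [leadingVector_cons]
      exact Finset.sum_nonneg (hnonneg σ hσ hcard)
    · have hσ : ∀ t, wordState (u ++ x :: v) u.length t = none ∨
          wordState (u ++ x :: v) u.length t = (u ++ x :: v)[t]? := by
        intro t
        rw [wordState]
        split_ifs <;> simp
      have hcard : (contents d (wordState (u ++ x :: v) u.length)).card = v.length + 1 := by
        rw [hd, contents_wordState]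
        simp
      rw [leadingVector_cons]
      refine Finset.sum_pos' (hnonneg _ hσ hcard) ⟨u.length, Finset.mem_range.mpr hu, ?_⟩
      rw [slotOp_leadingVector hw hσ hcard hu, if_pos (by simp [wordState]), update_wordState]
      simpa using ih2

open ComplexOrder in
lemma leadingVector_wordState_ne_zero {w : List (I × I × ℤ)}
    (hw : ∀ y ∈ w, Odd (p y.1 + p y.2.1) → w.count y ≤ 1) :
    leadingVector p w.length w (wordState w 0) ≠ 0 :=
  (leadingVector_nonneg_and_pos [] w hw rfl).2.ne'

lemma perm_of_leadingVector_ne_zero {w w' : List (I × I × ℤ)} (hlen : w'.length ≤ w.length)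
    (h : leadingVector p w.length w' (wordState w 0) ≠ 0) : w.Perm w' := by
  have hc : contents w.length (wordState w 0) = w := contents_wordState [] w
  obtain ⟨h1, h2⟩ := leadingVector_contents _ _ h
  rw [hc] at h1 h2
  exact Multiset.coe_eq_coe.mp (h2 (h1.antisymm hlen))

end LeadingTerm

section OrderedMonomials

variable {m n : ℕ}

/-- The row, the column and the degree of a generator. -/
def letter : GD m n → Fin (m + n) × Fin (m + n) × ℤ
  | Sum.inl (i, j, r) => (i, j, r)
  | Sum.inr (i, j, r) => (i, j, -((r : ℤ) + 1))

lemma letter_degree (g : GD m n) : (letter g).2.2 = degG m n g := by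
  rcases g with ⟨i, j, r⟩ | ⟨i, j, r⟩ <;> rfl

lemma letter_injective : Function.Injective (letter : GD m n → _) := by
  rintro (⟨i, j, r⟩ | ⟨i, j, r⟩) (⟨k, l, s⟩ | ⟨k, l, s⟩) h <;>
    simp only [letter, Prod.mk.injEq] at h <;> obtain ⟨rfl, rfl, h⟩ := h
  · rw [Nat.cast_injective h]
  · omega
  · omega
  · rw [show r = s by omega]

/-- The representation of the double Yangian on the functions on states. -/
def stateRep (m n d : ℕ) :
    DY m n →ₐ[ℂ] Module.End ℂ ((ℕ → Slot (Fin (m + n))) → ℂ) :=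
  transferHom (loopFamily_slotOp (par m)) d

lemma stateRep_genD_sub_leading_mem (d : ℕ) (g : GD m n) :
    stateRep m n d (genD m n g) - leading (par m) d (letter g) ∈ raisesBy d (degG m n g - 1) := by
  rw [stateRep, transferHom_genD]
  rcases g with ⟨i, j, r⟩ | ⟨i, j, r⟩
  · exact yangCoeff_sub_leading_mem (par m) d r i j
  · exact dualGen_sub_leading_mem (par m) d r i j

lemma prod_leading_mem (d : ℕ) (l : List (GD m n)) :
    ((l.map letter).map (leading (par m) d)).prod ∈ raisesBy d (l.map (degG m n)).sum := by
  induction l with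
  | nil => exact one_mem_raisesBy d
  | cons g l ih =>
    simp only [List.map_cons, List.prod_cons, List.sum_cons]
    refine raisesBy_mul ?_ ih
    rw [← letter_degree]
    exact leading_mem_raisesBy _ d _

lemma stateRep_monoD_sub_mem (d : ℕ) (l : List (GD m n)) :
    stateRep m n d (monoD m n l) - ((l.map letter).map (leading (par m) d)).prod ∈
      raisesBy d ((l.map (degG m n)).sum - 1) := by
  induction l with
  | nil => simp [monoD, zero_mem]
  | cons g l ih =>
    have h1 := stateRep_genD_sub_leading_mem d g
    have h2 := letter_degree g ▸ leading_mem_raisesBy (par m) d (letter g)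
    have h3 := add_mem (raisesBy_mono (by omega) h1) h2
    rw [sub_add_cancel] at h3
    have h4 := add_mem (raisesBy_mul h1 (prod_leading_mem d l))
      (raisesBy_mono (D' := degG m n g - 1 + (l.map (degG m n)).sum) (by omega)
        (raisesBy_mul h3 ih))
    rw [monoD] at h4 ⊢
    simp only [List.map_cons, List.prod_cons, List.sum_cons, map_mul] at h4 ⊢
    convert h4 using 1
    · rw [sub_add_eq_add_sub]
    · rw [sub_mul, mul_sub]
      abel

lemma vacuum_mem_degreeLE {I : Type*} (d : ℕ) : vacuum I ∈ degreeLE d 0 := by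
  intro σ hσ
  rw [vacuum, if_neg]
  rintro rfl
  simp [stateDegree, slotDegree] at hσ

/-- The state attached to a monomial. -/
def monomialState (G : List (GD m n)) : ℕ → Slot (Fin (m + n)) := wordState (G.map letter) 0

lemma stateDegree_monomialState (G : List (GD m n)) :
    stateDegree G.length (monomialState G) = (G.map (degG m n)).sum := by
  rw [stateDegree, ← Fin.sum_univ_eq_sum_range
    (fun t => slotDegree (monomialState G t)), ← Fin.sum_univ_fun_getElem]
  refine Finset.sum_congr rfl fun t _ => ?_
  rw [← letter_degree]
  simp [monomialState, wordState, slotDegree]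

/-- The value at the state attached to `G` of an element applied to the vacuum. -/
def evalAt (G : List (GD m n)) : DY m n →ₗ[ℂ] ℂ :=
  LinearMap.proj (monomialState G) ∘ₗ LinearMap.applyₗ (vacuum (Fin (m + n))) ∘ₗ
    (stateRep m n G.length).toLinearMap

lemma evalAt_monoD {G l : List (GD m n)} (h : (l.map (degG m n)).sum ≤ (G.map (degG m n)).sum) :
    evalAt G (monoD m n l) =
      leadingVector (par m) G.length (l.map letter) (monomialState G) := by
  have h1 := stateRep_monoD_sub_mem G.length l 0 _ (vacuum_mem_degreeLE _) (monomialState G)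
    (by rw [stateDegree_monomialState]; omega)
  exact sub_eq_zero.mp h1

lemma leadingVector_eq_zero_of_degree_lt {G l : List (GD m n)}
    (h : (l.map (degG m n)).sum < (G.map (degG m n)).sum) :
    leadingVector (par m) G.length (l.map letter) (monomialState G) = 0 :=
  prod_leading_mem G.length l 0 _ (vacuum_mem_degreeLE _) (monomialState G)
    (by rw [stateDegree_monomialState]; omega)

lemma isOddD_of_odd {g : GD m n} (h : Odd (par m (letter g).1 + par m (letter g).2.1)) :
    isOddD m n g := by
  rcases g with ⟨i, j, r⟩ | ⟨i, j, r⟩ <;>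
  · intro hij
    simp only [letter, hij] at h
    exact Nat.not_odd_iff_even.mpr ⟨_, rfl⟩ h

instance lawfulBEqSum {α β : Type*} [BEq α] [BEq β] [LawfulBEq α] [LawfulBEq β] :
    LawfulBEq (α ⊕ β) where
  eq_of_beq {x y} h := by
    rcases x with a | a <;> rcases y with b | b
    · exact congrArg Sum.inl (eq_of_beq (α := α) h)
    · cases h
    · cases h
    · exact congrArg Sum.inr (eq_of_beq (α := β) h)
  rfl {x} := by
    rcases x with a | a
    · exact beq_self_eq_true (α := α) a
    · exact beq_self_eq_true (α := β) a

lemma evalAt_self_ne_zero {G : List (GD m n)} (hG : OrderedMonomialD m n G) :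
    evalAt G (monoD m n G) ≠ 0 := by
  rw [evalAt_monoD le_rfl]
  have := leadingVector_wordState_ne_zero (p := par m) (w := G.map letter) ?_
  · rwa [List.length_map] at this
  · intro y hy hodd
    obtain ⟨g, hg, rfl⟩ := List.mem_map.mp hy
    rw [List.count_map_of_injective _ _ letter_injective]
    exact hG.2 g hg (isOddD_of_odd hodd)

lemma leG_antisymm {g h : GD m n} (h1 : leG m n g h) (h2 : leG m n h g) : g = h := by
  rcases g with ⟨i, j, r⟩ | ⟨i, j, r⟩ <;> rcases h with ⟨k, l, s⟩ | ⟨k, l, s⟩ <;>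
    simp only [leG, lexLT, Prod.mk.injEq, Sum.inl.injEq, Sum.inr.injEq] at * <;> omega

lemma evalAt_eq_zero {G l : List (GD m n)} (hG : OrderedMonomialD m n G)
    (hl : OrderedMonomialD m n l) (hne : l ≠ G)
    (h : toLex ((l.map (degG m n)).sum, l.length) ≤ toLex ((G.map (degG m n)).sum, G.length)) :
    evalAt G (monoD m n l) = 0 := by
  rcases Prod.Lex.toLex_le_toLex.mp h with hdeg | ⟨hdeg, hlen⟩
  · rw [evalAt_monoD hdeg.le, leadingVector_eq_zero_of_degree_lt hdeg]
  · by_contra hcon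
    rw [evalAt_monoD hdeg.le] at hcon
    have hperm := perm_of_leadingVector_ne_zero (p := par m) (w := G.map letter)
      (w' := l.map letter) (by simpa using hlen) (by rwa [List.length_map])
    have hperm' : l.Perm G := by
      rw [← Multiset.coe_eq_coe]
      apply Multiset.map_injective letter_injective
      exact (Multiset.coe_eq_coe.mpr hperm).symm
    exact hne (hperm'.eq_of_pairwise (fun _ _ _ _ => leG_antisymm) hl.1 hG.1)

lemma linearIndependent_of_triangular {K V ι Γ : Type*} [Field K] [AddCommGroup V] [Module K V]
    [LinearOrder Γ] (v : ι → V) (γ : ι → Γ) (φ : ι → V →ₗ[K] K) (hφ : ∀ i, φ i (v i) ≠ 0)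
    (hφ' : ∀ i j, j ≠ i → γ j ≤ γ i → φ i (v j) = 0) : LinearIndependent K v := by
  rw [linearIndependent_iff]
  intro c hc
  by_contra hne
  obtain ⟨i, hi, hmax⟩ := Finset.exists_max_image c.support γ (Finsupp.support_nonempty_iff.mpr hne)
  have h1 := congrArg (φ i) hc
  rw [map_zero, Finsupp.linearCombination_apply, Finsupp.sum, map_sum,
    Finset.sum_eq_single_of_mem i hi fun j hj hji => by
      rw [map_smul, hφ' i j hji (hmax j hj), smul_zero], map_smul, smul_eq_zero] at h1
  exact h1.elim (Finsupp.mem_support_iff.mp hi) (hφ i)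

end OrderedMonomials

end DoubleYangian

theorem statement14 (m n : ℕ) (hN : 1 ≤ m + n) (hmn : m ≠ n) :
    LinearIndependent ℂ
      (fun l : {l : List (GD m n) // OrderedMonomialD m n l} => monoD m n l.1) :=
  DoubleYangian.linearIndependent_of_triangular _
    (fun l => toLex ((l.1.map (degG m n)).sum, l.1.length))
    (fun l => DoubleYangian.evalAt l.1) (fun l => DoubleYangian.evalAt_self_ne_zero l.2)
    (fun G l hne h => DoubleYangian.evalAt_eq_zero G.2 l.2 (fun h' => hne (Subtype.ext h')) h)
end
end
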